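/- arXiv:1407.8465 — 3 statements merged into one kernel-verified Lean document; each statement's English description precedes it below -/
import Mathlib

section
/- Let p > 3 be a prime and let χ(p) = 1 if p ≡ 1 or 3 (mod 8) and χ(p) = -1 if p ≡ 5 or 7 (mod 8) (the Legendre symbol (-2/p)). Then χ(p) · Σ_{k=0}^{p-1} binom(4k,2k)·binom(2k,k)/64^k · H_k ≡ -6·q_p(2) + 3·p·q_p(2)² (mod p²). -/
open Finset

/-- Generalized binomial coefficient `C(a,k) = a(a-1)⋯(a-k+1)/k!` for a rational `a`. -/
noncomputable def gchoose (a : ℚ) (k : ℕ) : ℚ :=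
  (∏ j ∈ Finset.range k, (a - j)) / (Nat.factorial k : ℚ)

/-- The harmonic number `H_k = ∑_{j=1}^k 1/j`. -/
def harm (k : ℕ) : ℚ := ∑ j ∈ Finset.range k, (1 : ℚ) / (j + 1)

/-- The second-order harmonic number `H_k^{(2)} = ∑_{j=1}^k 1/j²`. -/
def harm2 (k : ℕ) : ℚ := ∑ j ∈ Finset.range k, (1 : ℚ) / (j + 1) ^ 2

/-- `x ≡ y (mod p^m)` for rationals: the p-adic valuation of `x - y` is at least `m`
(with the convention that the valuation of `0` is `+∞`). -/
def CongrMod (p m : ℕ) (x y : ℚ) : Prop :=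
  x = y ∨ (m : ℤ) ≤ padicValRat p (x - y)

/-- The Bernoulli polynomial `B_n` evaluated at a rational `x`. -/
noncomputable def bpoly (n : ℕ) (x : ℚ) : ℚ := (Polynomial.bernoulli n).eval x

/-- The Euler polynomial `E_n` evaluated at a rational `x`, via
`E_n(x) = (2/(n+1))·(B_{n+1}(x) − 2^{n+1}·B_{n+1}(x/2))`. -/
noncomputable def epoly (n : ℕ) (x : ℚ) : ℚ :=
  (2 / (n + 1 : ℚ)) * (bpoly (n + 1) x - 2 ^ (n + 1) * bpoly (n + 1) (x / 2))

/-- The Euler number `E_n = 2^n · E_n(1/2)`. -/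
noncomputable def eulerNum (n : ℕ) : ℚ := 2 ^ n * epoly n (1 / 2)

/-- The rational numbers that are integral at `p`. -/
def pIntegral (p : ℕ) [Fact p.Prime] : Subring ℚ where
  carrier := {x | padicNorm p x ≤ 1}
  mul_mem' {a b} ha hb := by
    simp only [Set.mem_ofPred_eq, padicNorm.mul] at *
    exact mul_le_one₀ ha (padicNorm.nonneg b) hb
  one_mem' := by simp
  add_mem' {a b} ha hb := le_trans padicNorm.nonarchimedean (max_le ha hb)
  zero_mem' := by simp
  neg_mem' {a} ha := by simpa using ha

/-- The rational numbers whose `p`-adic valuation is at least `m`. -/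
def pMultiples (p : ℕ) [Fact p.Prime] (m : ℕ) : AddSubgroup ℚ where
  carrier := {x | ∃ y ∈ pIntegral p, x = p ^ m * y}
  add_mem' := by
    rintro _ _ ⟨a, ha, rfl⟩ ⟨b, hb, rfl⟩
    exact ⟨a + b, add_mem ha hb, by ring⟩
  zero_mem' := ⟨0, zero_mem _, by simp⟩
  neg_mem' := by
    rintro _ ⟨a, ha, rfl⟩
    exact ⟨-a, neg_mem ha, by ring⟩

section Integrality

variable {p : ℕ} [Fact p.Prime]

theorem pow_mul_mem_pMultiples {y : ℚ} (m : ℕ) (hy : y ∈ pIntegral p) :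
    (p : ℚ) ^ m * y ∈ pMultiples p m := ⟨y, hy, rfl⟩

theorem mul_mem_pMultiples_add {m n : ℕ} {x y : ℚ} (hx : x ∈ pMultiples p m)
    (hy : y ∈ pMultiples p n) : x * y ∈ pMultiples p (m + n) := by
  obtain ⟨a, ha, rfl⟩ := hx
  obtain ⟨b, hb, rfl⟩ := hy
  exact ⟨a * b, mul_mem ha hb, by ring⟩

theorem mul_mem_pMultiples {m : ℕ} {x y : ℚ} (hx : x ∈ pIntegral p)
    (hy : y ∈ pMultiples p m) : x * y ∈ pMultiples p m := by
  obtain ⟨b, hb, rfl⟩ := hy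
  exact ⟨x * b, mul_mem hx hb, by ring⟩

theorem prime_mul_mem_pMultiples_succ {m : ℕ} {x : ℚ} (hx : x ∈ pMultiples p m) :
    (p : ℚ) * x ∈ pMultiples p (m + 1) := by
  obtain ⟨b, hb, rfl⟩ := hx
  exact ⟨b, hb, by ring⟩

theorem mem_pMultiples_of_prime_mul {m : ℕ} {x : ℚ}
    (hx : (p : ℚ) * x ∈ pMultiples p (m + 1)) : x ∈ pMultiples p m := by
  obtain ⟨b, hb, h⟩ := hx
  have hp : (p : ℚ) ≠ 0 := by exact_mod_cast (Fact.out : p.Prime).ne_zero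
  refine ⟨b, hb, mul_left_cancel₀ hp ?_⟩
  rw [h]; ring

theorem pMultiples_succ_le {m : ℕ} {x : ℚ} (hx : x ∈ pMultiples p (m + 1)) :
    x ∈ pMultiples p m := by
  obtain ⟨b, hb, rfl⟩ := hx
  exact ⟨p * b, mul_mem (natCast_mem _ p) hb, by ring⟩

theorem mem_pIntegral_of_mem_pMultiples {m : ℕ} {x : ℚ} (hx : x ∈ pMultiples p m) :
    x ∈ pIntegral p := by
  obtain ⟨b, hb, rfl⟩ := hx
  exact mul_mem (pow_mem (natCast_mem _ p) m) hb

theorem inv_intCast_mem_pIntegral {z : ℤ} (hz : ¬ (p : ℤ) ∣ z) :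
    ((z : ℚ))⁻¹ ∈ pIntegral p := by
  have h : padicNorm p (z : ℚ) = 1 := (padicNorm.int_eq_one_iff z).2 hz
  have h1 : padicNorm p ((z : ℚ))⁻¹ = 1 := by
    rw [inv_eq_one_div, padicNorm.div, h]; simp
  exact h1.le

theorem inv_natCast_mem_pIntegral {n : ℕ} (h0 : 0 < n) (h : n < p) :
    ((n : ℚ))⁻¹ ∈ pIntegral p := by
  have : ¬ (p : ℤ) ∣ (n : ℤ) := by
    intro hd
    exact absurd (Nat.le_of_dvd h0 (Int.natCast_dvd_natCast.1 hd)) (by omega)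
  simpa using inv_intCast_mem_pIntegral this

theorem inv_succ_mem_pIntegral {i : ℕ} (h : i + 1 < p) :
    ((i : ℚ) + 1)⁻¹ ∈ pIntegral p := by
  simpa using inv_natCast_mem_pIntegral (p := p) (Nat.succ_pos i) h

theorem congrMod_of_sub_mem {m : ℕ} {x y : ℚ} (h : x - y ∈ pMultiples p m) :
    CongrMod p m x y := by
  obtain ⟨b, hb, hxy⟩ := h
  by_cases hb0 : b = 0
  · left
    rw [hb0, mul_zero] at hxy
    linarith
  · right
    have hp1 : 1 < (p : ℚ) := by exact_mod_cast (Fact.out : p.Prime).one_lt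
    have hp : (p : ℚ) ≠ 0 := by positivity
    have hb1 : padicNorm p b ≤ 1 := hb
    rw [padicNorm.eq_zpow_of_nonzero hb0] at hb1
    have := (zpow_le_one_iff_right₀ hp1).1 hb1
    rw [hxy, padicValRat.mul (pow_ne_zero m hp) hb0, padicValRat.pow,
      padicValRat.self (Fact.out : p.Prime).one_lt]
    linarith

end Integrality

/-- The product `C(x,k) · C(-1-x,k)`. -/
def legendreTerm (x : ℚ) (k : ℕ) : ℚ :=
  ∏ j ∈ range k, ((x - j) * (-1 - x - j) / ((j : ℚ) + 1) ^ 2)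

/-- The product `C(x-1,k) · C(-1-x,k)`. -/
def legendreCert (x : ℚ) (k : ℕ) : ℚ :=
  ∏ j ∈ range k, ((x - 1 - j) * (-1 - x - j) / ((j : ℚ) + 1) ^ 2)

theorem harm_succ (k : ℕ) : harm (k + 1) = harm k + ((k : ℚ) + 1)⁻¹ := by
  simp [harm, sum_range_succ]

theorem legendreTerm_succ (x : ℚ) (k : ℕ) :
    legendreTerm x (k + 1) = -(legendreCert x k * x * (x + k + 1) / ((k : ℚ) + 1) ^ 2) := by
  induction k with
  | zero => simp [legendreTerm, legendreCert]; ring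
  | succ k ih =>
    rw [legendreTerm, prod_range_succ, ← legendreTerm, ih, legendreCert, legendreCert,
      prod_range_succ]
    push_cast
    have h1 : (k : ℚ) + 1 ≠ 0 := by positivity
    have h2 : (k : ℚ) + 1 + 1 ≠ 0 := by positivity
    field_simp
    ring

theorem legendreTerm_sub_one_succ (x : ℚ) (k : ℕ) :
    legendreTerm (x - 1) (k + 1) =
      -(legendreCert x k * x * (x - k - 1) / ((k : ℚ) + 1) ^ 2) := by
  induction k with
  | zero => simp [legendreTerm, legendreCert]; ring
  | succ k ih =>
    rw [legendreTerm, prod_range_succ, ← legendreTerm, ih, legendreCert, legendreCert,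
      prod_range_succ]
    push_cast
    have h1 : (k : ℚ) + 1 ≠ 0 := by positivity
    have h2 : (k : ℚ) + 1 + 1 ≠ 0 := by positivity
    field_simp
    ring

theorem legendreCert_succ (x : ℚ) (k : ℕ) :
    legendreCert x (k + 1) =
      legendreCert x k * ((x - 1 - k) * (-1 - x - k) / ((k : ℚ) + 1) ^ 2) := by
  simp only [legendreCert, prod_range_succ]

theorem sum_legendreTerm_add (x : ℚ) (N : ℕ) :
    ∑ k ∈ range (N + 1), legendreTerm x k + ∑ k ∈ range (N + 1), legendreTerm (x - 1) k =
      2 * legendreCert x N := by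
  induction N with
  | zero => simp [legendreTerm, legendreCert]; norm_num
  | succ N ih =>
    rw [sum_range_succ, sum_range_succ _ (N + 1), legendreTerm_succ, legendreTerm_sub_one_succ,
      legendreCert_succ]
    have h1 : (N : ℚ) + 1 ≠ 0 := by positivity
    rw [← sub_eq_zero] at ih ⊢
    rw [← ih]
    field_simp
    ring

theorem sum_legendreTerm_mul_harm_add {x : ℚ} (hx : x ≠ 0) (N : ℕ) :
    ∑ k ∈ range (N + 1), legendreTerm x k * harm k +
        ∑ k ∈ range (N + 1), legendreTerm (x - 1) k * harm k =
      2 * harm N * legendreCert x N + (∑ k ∈ range (N + 1), legendreTerm x k -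
        ∑ k ∈ range (N + 1), legendreTerm (x - 1) k) / x := by
  induction N with
  | zero => simp [legendreTerm, harm]
  | succ N ih =>
    rw [sum_range_succ, sum_range_succ _ (N + 1), sum_range_succ _ (N + 1),
      sum_range_succ _ (N + 1), legendreTerm_succ, legendreTerm_sub_one_succ,
      legendreCert_succ, harm_succ]
    have h1 : (N : ℚ) + 1 ≠ 0 := by positivity
    rw [← sub_eq_zero] at ih ⊢
    rw [← ih]
    field_simp
    ring

theorem sum_range_two_mul_succ (f : ℕ → ℚ) (h : ℕ) :
    ∑ i ∈ range (2 * h), f (i + 1) =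
      ∑ i ∈ range h, f (2 * i + 1) + ∑ i ∈ range h, f (2 * (i + 1)) := by
  induction h with
  | zero => simp
  | succ h ih =>
    rw [show 2 * (h + 1) = 2 * h + 1 + 1 by ring, sum_range_succ, sum_range_succ, ih,
      sum_range_succ, sum_range_succ]
    ring_nf

theorem sum_range_even_add_odd (f : ℕ → ℚ) (h : ℕ) :
    ∑ i ∈ range h, f (i + 1) =
      ∑ i ∈ range (h / 2), f (2 * (i + 1)) + ∑ i ∈ range (h - h / 2), f (2 * i + 1) := by
  rcases Nat.even_or_odd' h with ⟨c, rfl | rfl⟩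
  · rw [sum_range_two_mul_succ, show 2 * c / 2 = c by omega, show 2 * c - c = c by omega, add_comm]
  · rw [sum_range_succ, sum_range_two_mul_succ, show (2 * c + 1) / 2 = c by omega,
      show 2 * c + 1 - c = c + 1 by omega, sum_range_succ]
    ring

theorem harm2_two_mul_eq_reflect {p h : ℕ} (hh : p = 2 * h + 1) :
    harm2 (2 * h) = harm2 h + ∑ i ∈ range h, ((p : ℚ) - (1 : ℕ) * ((i + 1 : ℕ) : ℚ))⁻¹ ^ 2 := by
  rw [harm2, two_mul, sum_range_add, ← harm2]
  congr 1
  rw [← sum_range_reflect]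
  refine sum_congr rfl fun i hi => ?_
  have hi := mem_range.1 hi
  obtain ⟨d, rfl⟩ : ∃ d, h = i + 1 + d := ⟨h - (i + 1), by omega⟩
  rw [show i + 1 + d - 1 - i = d by omega, hh, one_div, ← inv_pow]
  congr 2
  push_cast
  ring

theorem harm2_two_mul_eq_even_odd {p h : ℕ} (hh : p = 2 * h + 1) :
    harm2 (2 * h) = 2⁻¹ ^ 2 * harm2 h +
      ∑ i ∈ range h, ((p : ℚ) - (2 : ℕ) * ((i + 1 : ℕ) : ℚ))⁻¹ ^ 2 := by
  have := sum_range_two_mul_succ (fun n => ((n : ℚ))⁻¹ ^ 2) h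
  have e : harm2 (2 * h) = ∑ i ∈ range (2 * h), (((i + 1 : ℕ) : ℚ))⁻¹ ^ 2 := by
    simp [harm2]
  rw [e, this, add_comm]
  congr 1
  · rw [harm2, mul_sum]
    refine sum_congr rfl fun i _ => ?_
    push_cast
    rw [mul_inv, mul_pow, one_div, inv_pow ((i : ℚ) + 1)]
  · rw [← sum_range_reflect]
    refine sum_congr rfl fun i hi => ?_
    have hi := mem_range.1 hi
    obtain ⟨d, rfl⟩ : ∃ d, h = i + 1 + d := ⟨h - (i + 1), by omega⟩
    rw [show i + 1 + d - 1 - i = d by omega, hh]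
    congr 2
    push_cast
    ring

theorem prod_range_add_succ (h : ℕ) :
    ∏ i ∈ range h, ((h : ℚ) + 1 + i) = 2 ^ h * ∏ i ∈ range h, (2 * (i : ℚ) + 1) := by
  induction h with
  | zero => simp
  | succ h ih =>
    have h0 : (h : ℚ) + 1 ≠ 0 := by positivity
    have e : ((h : ℚ) + 1) * ∏ i ∈ range (h + 1), ((h : ℚ) + 1 + 1 + i) =
        (∏ i ∈ range h, ((h : ℚ) + 1 + i)) * (2 * h + 1) * (2 * (h + 1)) := by
      have e1 := prod_range_succ' (fun i : ℕ => (h : ℚ) + 1 + i) (h + 1)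
      rw [prod_range_succ, prod_range_succ] at e1
      push_cast at e1
      rw [mul_comm]
      rw [show ∏ i ∈ range (h + 1), ((h : ℚ) + 1 + 1 + i) =
        ∏ i ∈ range (h + 1), ((h : ℚ) + 1 + ((i : ℚ) + 1)) from
          prod_congr rfl fun i _ => by ring]
      rw [add_zero] at e1
      rw [← e1]
      ring
    push_cast
    apply mul_left_cancel₀ h0
    rw [e, ih, prod_range_succ]
    ring

theorem prod_one_sub_eq {p h : ℕ} (hh : p = 2 * h + 1) :
    ∏ i ∈ range h, (1 - (p : ℚ) * ((i : ℚ) + 1)⁻¹) =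
      2 ^ (p - 1) * ∏ i ∈ range h, (1 - (p : ℚ) * (2⁻¹ * ((i : ℚ) + 1)⁻¹)) := by
  have e1 : ∏ i ∈ range h, (1 - (p : ℚ) * ((i : ℚ) + 1)⁻¹) =
      (∏ i ∈ range h, ((h : ℚ) + 1 + i)) * ∏ i ∈ range h, (-((i : ℚ) + 1)⁻¹) := by
    rw [← prod_range_reflect (fun i => (h : ℚ) + 1 + (i : ℚ)), ← prod_mul_distrib]
    refine prod_congr rfl fun i hi => ?_
    have hi := mem_range.1 hi
    obtain ⟨d, rfl⟩ : ∃ d, h = i + 1 + d := ⟨h - (i + 1), by omega⟩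
    rw [show i + 1 + d - 1 - i = d by omega, hh]
    have : (i : ℚ) + 1 ≠ 0 := by positivity
    push_cast
    field_simp
    ring
  have e2 : 2 ^ h * ∏ i ∈ range h, (1 - (p : ℚ) * (2⁻¹ * ((i : ℚ) + 1)⁻¹)) =
      (∏ i ∈ range h, (2 * (i : ℚ) + 1)) * ∏ i ∈ range h, (-((i : ℚ) + 1)⁻¹) := by
    have e0 : (2 : ℚ) ^ h = ∏ _i ∈ range h, (2 : ℚ) := by simp
    rw [← prod_range_reflect (fun i => 2 * (i : ℚ) + 1), ← prod_mul_distrib,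
      e0, ← prod_mul_distrib]
    refine prod_congr rfl fun i hi => ?_
    have hi := mem_range.1 hi
    obtain ⟨d, rfl⟩ : ∃ d, h = i + 1 + d := ⟨h - (i + 1), by omega⟩
    rw [show i + 1 + d - 1 - i = d by omega, hh]
    have : (i : ℚ) + 1 ≠ 0 := by positivity
    push_cast
    field_simp
    ring
  have e3 : (2 : ℚ) ^ (p - 1) = 2 ^ h * 2 ^ h := by rw [hh, ← pow_add]; congr 1; omega
  rw [e1, e3, mul_assoc, e2, prod_range_add_succ]
  ring

section Congruences

variable {p : ℕ} [Fact p.Prime]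

theorem not_dvd_sub_mul {m k : ℕ} (hm : 0 < m) (hmp : m < p) (hk : 0 < k) (hkp : k < p) :
    ¬ (p : ℤ) ∣ (p : ℤ) - k * m := by
  intro h
  have h1 : (p : ℤ) ∣ ((k * m : ℕ) : ℤ) := by
    have := (dvd_sub_right (dvd_refl (p : ℤ))).1 h
    exact_mod_cast this
  rcases (Nat.Prime.dvd_mul Fact.out).1 (Int.natCast_dvd_natCast.1 h1) with h | h
  · exact absurd (Nat.le_of_dvd hk h) (by omega)
  · exact absurd (Nat.le_of_dvd hm h) (by omega)

theorem inv_sub_mul_mem {m k : ℕ} (hm : 0 < m) (hmp : m < p) (hk : 0 < k) (hkp : k < p) :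
    ((p : ℚ) - k * m)⁻¹ ∈ pIntegral p := by
  simpa using inv_intCast_mem_pIntegral (not_dvd_sub_mul hm hmp hk hkp)

theorem sub_mul_ne_zero {m k : ℕ} (hm : 0 < m) (hmp : m < p) (hk : 0 < k) (hkp : k < p) :
    (p : ℚ) - k * m ≠ 0 := by
  have h := not_dvd_sub_mul hm hmp hk hkp
  intro h0
  apply h
  have : (p : ℤ) - k * m = 0 := by exact_mod_cast h0
  rw [this]
  exact dvd_zero _

/-- Expansion of `1 / (p - k m)` to second order. -/
theorem inv_sub_mul_congr {m k : ℕ} (hm : 0 < m) (hmp : m < p) (hk : 0 < k) (hkp : k < p) :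
    ((p : ℚ) - k * m)⁻¹ - (-((k : ℚ)⁻¹ * (m : ℚ)⁻¹) - p * ((k : ℚ)⁻¹ ^ 2 * (m : ℚ)⁻¹ ^ 2)) ∈
      pMultiples p 2 := by
  have h0 := sub_mul_ne_zero hm hmp hk hkp
  have hk0 : (k : ℚ) ≠ 0 := by positivity
  have hm0 : (m : ℚ) ≠ 0 := by positivity
  have e : ((p : ℚ) - k * m)⁻¹ -
      (-((k : ℚ)⁻¹ * (m : ℚ)⁻¹) - p * ((k : ℚ)⁻¹ ^ 2 * (m : ℚ)⁻¹ ^ 2)) =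
      (p : ℚ) ^ 2 * ((k : ℚ)⁻¹ ^ 2 * (m : ℚ)⁻¹ ^ 2 * ((p : ℚ) - k * m)⁻¹) := by
    field_simp
    ring
  rw [e]
  have a := inv_natCast_mem_pIntegral hk hkp
  have b := inv_natCast_mem_pIntegral hm hmp
  exact pow_mul_mem_pMultiples 2
    (mul_mem (mul_mem (pow_mem a 2) (pow_mem b 2)) (inv_sub_mul_mem hm hmp hk hkp))

theorem sum_inv_sub_mul_congr {h k : ℕ} (hh : h < p) (hk : 0 < k) (hkp : k < p) :
    ∑ i ∈ range h, ((p : ℚ) - k * ((i + 1 : ℕ) : ℚ))⁻¹ -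
      (-((k : ℚ)⁻¹ * harm h) - p * ((k : ℚ)⁻¹ ^ 2 * harm2 h)) ∈ pMultiples p 2 := by
  have e : ∑ i ∈ range h, ((p : ℚ) - k * ((i + 1 : ℕ) : ℚ))⁻¹ -
      (-((k : ℚ)⁻¹ * harm h) - p * ((k : ℚ)⁻¹ ^ 2 * harm2 h)) =
      ∑ i ∈ range h, (((p : ℚ) - k * ((i + 1 : ℕ) : ℚ))⁻¹ -
        (-((k : ℚ)⁻¹ * ((i + 1 : ℕ) : ℚ)⁻¹) -
          p * ((k : ℚ)⁻¹ ^ 2 * ((i + 1 : ℕ) : ℚ)⁻¹ ^ 2))) := by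
    simp only [harm, harm2, sum_sub_distrib, sum_neg_distrib, mul_sum]
    simp
  rw [e]
  refine sum_mem fun i hi => inv_sub_mul_congr (Nat.succ_pos i) ?_ hk hkp
  have := mem_range.1 hi
  omega

theorem harm_mem {k : ℕ} (hk : k < p) : harm k ∈ pIntegral p := by
  refine sum_mem fun i hi => ?_
  rw [one_div]
  have := mem_range.1 hi
  exact inv_succ_mem_pIntegral (by omega)

theorem harm2_mem {k : ℕ} (hk : k < p) : harm2 k ∈ pIntegral p := by
  refine sum_mem fun i hi => ?_
  rw [one_div, ← inv_pow]
  have := mem_range.1 hi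
  exact pow_mem (inv_succ_mem_pIntegral (by omega)) 2

theorem inv_two_mem (hp3 : 3 < p) : (2 : ℚ)⁻¹ ∈ pIntegral p := by
  exact_mod_cast inv_natCast_mem_pIntegral (p := p) (n := 2) (by omega) (by omega)

theorem inv_three_mem (hp3 : 3 < p) : (3 : ℚ)⁻¹ ∈ pIntegral p := by
  exact_mod_cast inv_natCast_mem_pIntegral (p := p) (n := 3) (by omega) (by omega)

theorem inv_four_mem (hp3 : 3 < p) : (4 : ℚ)⁻¹ ∈ pIntegral p := by
  have : (4 : ℚ)⁻¹ = 2⁻¹ * 2⁻¹ := by norm_num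
  rw [this]
  exact mul_mem (inv_two_mem hp3) (inv_two_mem hp3)

theorem inv_sub_sq_congr {k m : ℕ} (hm : 0 < m) (hmp : m < p) (hk : 0 < k) (hkp : k < p) :
    ((p : ℚ) - k * m)⁻¹ ^ 2 - (k : ℚ)⁻¹ ^ 2 * (m : ℚ)⁻¹ ^ 2 ∈ pMultiples p 1 := by
  have h0 := sub_mul_ne_zero hm hmp hk hkp
  have hk0 : (k : ℚ) ≠ 0 := by positivity
  have hm0 : (m : ℚ) ≠ 0 := by positivity
  have a := inv_natCast_mem_pIntegral hk hkp
  have b := inv_natCast_mem_pIntegral hm hmp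
  have c := inv_sub_mul_mem hm hmp hk hkp
  have e : ((p : ℚ) - k * m)⁻¹ ^ 2 - (k : ℚ)⁻¹ ^ 2 * (m : ℚ)⁻¹ ^ 2 =
      (p : ℚ) ^ 1 * (((k : ℚ)⁻¹ * (m : ℚ)⁻¹) * ((p : ℚ) - k * m)⁻¹ *
        (((p : ℚ) - k * m)⁻¹ - (k : ℚ)⁻¹ * (m : ℚ)⁻¹)) := by
    field_simp
    ring
  rw [e]
  exact pow_mul_mem_pMultiples 1
    (mul_mem (mul_mem (mul_mem a b) c) (sub_mem c (mul_mem a b)))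

theorem sum_inv_sub_sq_congr {h k : ℕ} (hh : h < p) (hk : 0 < k) (hkp : k < p) :
    ∑ i ∈ range h, ((p : ℚ) - k * ((i + 1 : ℕ) : ℚ))⁻¹ ^ 2 -
      (k : ℚ)⁻¹ ^ 2 * harm2 h ∈ pMultiples p 1 := by
  have e : ∑ i ∈ range h, ((p : ℚ) - k * ((i + 1 : ℕ) : ℚ))⁻¹ ^ 2 -
      (k : ℚ)⁻¹ ^ 2 * harm2 h =
      ∑ i ∈ range h, (((p : ℚ) - k * ((i + 1 : ℕ) : ℚ))⁻¹ ^ 2 -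
        (k : ℚ)⁻¹ ^ 2 * ((i + 1 : ℕ) : ℚ)⁻¹ ^ 2) := by
    simp only [harm2, sum_sub_distrib, mul_sum]
    simp
  rw [e]
  refine sum_mem fun i hi => inv_sub_sq_congr (Nat.succ_pos i) ?_ hk hkp
  have := mem_range.1 hi
  omega

theorem harm2_half_mem (hp3 : 3 < p) {h : ℕ} (hh : p = 2 * h + 1) :
    harm2 h ∈ pMultiples p 1 := by
  have a := sum_inv_sub_sq_congr (p := p) (h := h) (k := 1) (by omega) (by omega) (by omega)
  have b := sum_inv_sub_sq_congr (p := p) (h := h) (k := 2) (by omega) (by omega) (by omega)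
  have ea := harm2_two_mul_eq_reflect hh
  have eb := harm2_two_mul_eq_even_odd hh
  set X := ∑ i ∈ range h, ((p : ℚ) - (1 : ℕ) * ((i + 1 : ℕ) : ℚ))⁻¹ ^ 2
  set Y := ∑ i ∈ range h, ((p : ℚ) - (2 : ℕ) * ((i + 1 : ℕ) : ℚ))⁻¹ ^ 2
  have e : harm2 h = (2 * 3⁻¹) * ((Y - ((2 : ℕ) : ℚ)⁻¹ ^ 2 * harm2 h) -
      (X - ((1 : ℕ) : ℚ)⁻¹ ^ 2 * harm2 h)) := by
    push_cast
    linear_combination (2 / 3) * eb - (2 / 3) * ea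
  rw [e]
  exact mul_mem_pMultiples (mul_mem (by exact_mod_cast natCast_mem (pIntegral p) 2)
    (inv_three_mem hp3)) (sub_mem b a)

theorem harm2_pred_mem (hp3 : 3 < p) {h : ℕ} (hh : p = 2 * h + 1) :
    harm2 (2 * h) ∈ pMultiples p 1 := by
  have a := sum_inv_sub_sq_congr (p := p) (h := h) (k := 1) (by omega) (by omega) (by omega)
  have b := harm2_half_mem hp3 hh
  rw [harm2_two_mul_eq_reflect hh]
  have := add_mem (add_mem a b) b
  convert this using 1
  push_cast
  ring

theorem harm_pred_mem (hp3 : 3 < p) {h : ℕ} (hh : p = 2 * h + 1) :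
    harm (2 * h) ∈ pMultiples p 1 := by
  have a := sum_inv_sub_mul_congr (p := p) (h := 2 * h) (k := 1) (by omega) (by omega) (by omega)
  have e : ∑ i ∈ range (2 * h), ((p : ℚ) - (1 : ℕ) * ((i + 1 : ℕ) : ℚ))⁻¹ = harm (2 * h) := by
    rw [harm, ← sum_range_reflect]
    refine sum_congr rfl fun i hi => ?_
    have hi := mem_range.1 hi
    obtain ⟨d, hd⟩ : ∃ d, 2 * h = i + 1 + d := ⟨2 * h - (i + 1), by omega⟩
    rw [hh, hd, show i + 1 + d - 1 - i = d by omega, one_div]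
    congr 1
    push_cast
    ring
  rw [e] at a
  have b : (p : ℚ) ^ 1 * harm2 (2 * h) ∈ pMultiples p 1 :=
    pow_mul_mem_pMultiples 1 (harm2_mem (by omega))
  have c := mul_mem_pMultiples (inv_two_mem hp3) (sub_mem (pMultiples_succ_le a) b)
  convert c using 1
  push_cast
  ring

theorem prod_one_sub_congr (hp3 : 3 < p) (y : ℕ → ℚ) (h : ℕ)
    (hy : ∀ i < h, y i ∈ pIntegral p) :
    ∏ i ∈ range h, (1 - p * y i) - (1 - p * ∑ i ∈ range h, y i +
      p ^ 2 * 2⁻¹ * ((∑ i ∈ range h, y i) ^ 2 - ∑ i ∈ range h, y i ^ 2)) ∈ pMultiples p 3 := by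
  induction h with
  | zero => simp [zero_mem]
  | succ h ih =>
    have ih := ih fun i hi => hy i (by omega)
    have hs : ∑ i ∈ range h, y i ∈ pIntegral p :=
      sum_mem fun i hi => hy i (by have := mem_range.1 hi; omega)
    have hs2 : ∑ i ∈ range h, y i ^ 2 ∈ pIntegral p :=
      sum_mem fun i hi => pow_mem (hy i (by have := mem_range.1 hi; omega)) 2
    have hh := hy h (by omega)
    rw [prod_range_succ, sum_range_succ, sum_range_succ]
    set s := ∑ i ∈ range h, y i
    set s2 := ∑ i ∈ range h, y i ^ 2
    set P := ∏ i ∈ range h, (1 - p * y i)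
    have h1 : 1 - p * y h ∈ pIntegral p := sub_mem (one_mem _) (mul_mem (natCast_mem _ p) hh)
    have h2 : (p : ℚ) ^ 3 * (y h * 2⁻¹ * (s ^ 2 - s2)) ∈ pMultiples p 3 :=
      pow_mul_mem_pMultiples 3
        (mul_mem (mul_mem hh (inv_two_mem hp3)) (sub_mem (pow_mem hs 2) hs2))
    have h3 := sub_mem (mul_mem_pMultiples h1 ih) h2
    convert h3 using 1
    ring

/-- `H_{(p-1)/2} ≡ -2 q_p(2) + p q_p(2)²` modulo `p²`. -/
theorem harm_half_congr (hp3 : 3 < p) {h : ℕ} (hh : p = 2 * h + 1) :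
    harm h - (-2 * (((2 : ℚ) ^ (p - 1) - 1) / p) + p * (((2 : ℚ) ^ (p - 1) - 1) / p) ^ 2) ∈
      pMultiples p 2 := by
  have hp0 : (p : ℚ) ≠ 0 := by exact_mod_cast (Fact.out : p.Prime).ne_zero
  have hy : ∀ i < h, ((i : ℚ) + 1)⁻¹ ∈ pIntegral p :=
    fun i hi => inv_succ_mem_pIntegral (by omega)
  have a := prod_one_sub_congr hp3 _ h hy
  have b := prod_one_sub_congr hp3 (fun i : ℕ => 2⁻¹ * ((i : ℚ) + 1)⁻¹) h
    fun i hi => mul_mem (inv_two_mem hp3) (hy i hi)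
  have hH : harm h ∈ pIntegral p := harm_mem (by omega)
  have hP := harm2_half_mem hp3 hh
  rw [prod_one_sub_eq hh] at a
  have s1 : ∑ i ∈ range h, ((i : ℚ) + 1)⁻¹ = harm h := by simp [harm]
  have s2 : ∑ i ∈ range h, ((i : ℚ) + 1)⁻¹ ^ 2 = harm2 h := by simp [harm2]
  simp only [mul_pow, ← mul_sum] at b
  rw [s1, s2] at a b
  set q := ((2 : ℚ) ^ (p - 1) - 1) / p with hq
  have hz : (2 : ℚ) ^ (p - 1) = 1 + p * q := by rw [hq]; field_simp; ring
  rw [hz] at a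
  set B := ∏ i ∈ range h, (1 - (p : ℚ) * (2⁻¹ * ((i : ℚ) + 1)⁻¹))
  have hqI : q ∈ pIntegral p := by
    have hd : p ∣ 2 ^ (p - 1) - 1 := by
      have h1 : (2 ^ (p - 1)) ≡ 1 [MOD p] := by
        have := Nat.ModEq.pow_totient (x := 2) (n := p)
          ((Nat.coprime_primes Nat.prime_two Fact.out).2 (by omega))
        rwa [Nat.totient_prime Fact.out] at this
      exact (Nat.modEq_iff_dvd' Nat.one_le_two_pow).1 h1.symm
    obtain ⟨c, hc⟩ := hd
    have : q = (c : ℚ) := by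
      rw [hq, div_eq_iff hp0]
      have h2 : 2 ^ (p - 1) = p * c + 1 := by
        have := Nat.one_le_two_pow (n := p - 1)
        omega
      have h3 : (2 : ℚ) ^ (p - 1) = p * c + 1 := by exact_mod_cast h2
      rw [h3]; ring
    rw [this]
    exact natCast_mem _ c
  have h2 := inv_two_mem (p := p) hp3
  have hpI := natCast_mem (pIntegral p) p
  have two : (2 : ℚ) ∈ pIntegral p := by exact_mod_cast natCast_mem (pIntegral p) 2
  have three : (3 : ℚ) ∈ pIntegral p := by exact_mod_cast natCast_mem (pIntegral p) 3
  have hzI : 1 + p * q ∈ pIntegral p := add_mem (one_mem _) (mul_mem hpI hqI)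
  set H := harm h
  set P := harm2 h
  have c1 := sub_mem a (mul_mem_pMultiples hzI b)
  have c2 := prime_mul_mem_pMultiples_succ (prime_mul_mem_pMultiples_succ hP)
  have c3 : (p : ℚ) ^ 3 * (q * 2⁻¹ ^ 3 * H ^ 2 - q * 2⁻¹ ^ 3 * P) ∈ pMultiples p 3 :=
    pow_mul_mem_pMultiples 3 (sub_mem (mul_mem (mul_mem hqI (pow_mem h2 3)) (pow_mem hH 2))
      (mul_mem (mul_mem hqI (pow_mem h2 3)) (mem_pIntegral_of_mem_pMultiples hP)))
  have key : H + 2 * q - p * q * H - 3 * p * 2⁻¹ ^ 2 * H ^ 2 ∈ pMultiples p 2 := by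
    apply mem_pMultiples_of_prime_mul
    have := mul_mem_pMultiples two (sub_mem (sub_mem c1 c3)
      (mul_mem_pMultiples (mul_mem three (pow_mem h2 3)) c2))
    convert this using 1
    ring
  have key1 : H + 2 * q ∈ pMultiples p 1 := by
    have c4 : (p : ℚ) ^ 1 * (q * H + 3 * 2⁻¹ ^ 2 * H ^ 2) ∈ pMultiples p 1 :=
      pow_mul_mem_pMultiples 1 (add_mem (mul_mem hqI hH)
        (mul_mem (mul_mem three (pow_mem h2 2)) (pow_mem hH 2)))
    have := add_mem (pMultiples_succ_le key) c4
    convert this using 1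
    ring
  have c5 := mul_mem_pMultiples (sub_mem (mul_mem (mul_mem three (pow_mem h2 2)) hH)
    (mul_mem h2 hqI)) (prime_mul_mem_pMultiples_succ key1)
  have := add_mem key c5
  convert this using 1
  ring

/-- `8 ∑_{0 < i ≤ p/4} 1/(p - 4i) ≡ -3 H_{(p-1)/2}` modulo `p²`. -/
theorem sum_inv_sub_four_mul_congr (hp3 : 3 < p) {h : ℕ} (hh : p = 2 * h + 1) :
    8 * ∑ i ∈ range (p / 4), ((p : ℚ) - 4 * ((i : ℚ) + 1))⁻¹ + 3 * harm h ∈ pMultiples p 2 := by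
  have four : (4 : ℚ) ∈ pIntegral p := by exact_mod_cast natCast_mem (pIntegral p) 4
  have a := sum_inv_sub_mul_congr (p := p) (h := h) (k := 2) (by omega) (by omega) (by omega)
  have b := sum_inv_sub_mul_congr (p := p) (h := h) (k := 4) (by omega) (by omega) (by omega)
  have hP := prime_mul_mem_pMultiples_succ (harm2_half_mem hp3 hh)
  have hn : h / 2 = p / 4 := by omega
  have e1 := sum_range_even_add_odd (fun m => ((p : ℚ) - (2 : ℕ) * (m : ℚ))⁻¹) h
  rw [hn] at e1
  have e2 : ∑ i ∈ range h, ((p : ℚ) - (4 : ℕ) * ((i + 1 : ℕ) : ℚ))⁻¹ =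
      ∑ i ∈ range (p / 4), ((p : ℚ) - 4 * ((i : ℚ) + 1))⁻¹ -
        ∑ i ∈ range (h - p / 4), ((p : ℚ) - (2 : ℕ) * ((2 * i + 1 : ℕ) : ℚ))⁻¹ := by
    obtain ⟨d, hd⟩ : ∃ d, h = p / 4 + d := ⟨h - p / 4, by omega⟩
    rw [show h - p / 4 = d by omega]
    nth_rewrite 1 [hd]
    rw [sum_range_add, sub_eq_add_neg, ← sum_neg_distrib]
    congr 1
    · simp
    · rw [← sum_range_reflect]
      refine sum_congr rfl fun i hi => ?_
      have hi := mem_range.1 hi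
      rw [← inv_neg]
      congr 1
      have h1 : p / 4 + (d - 1 - i) + 1 + i = h := by omega
      have h2 : ((p / 4 + (d - 1 - i) + 1 : ℕ) : ℚ) = h - i := by
        rw [← h1]; push_cast; ring
      rw [h2, hh]
      push_cast
      ring
  have e3 : ∑ i ∈ range (p / 4), ((p : ℚ) - (2 : ℕ) * ((2 * (i + 1) : ℕ) : ℚ))⁻¹ =
      ∑ i ∈ range (p / 4), ((p : ℚ) - 4 * ((i : ℚ) + 1))⁻¹ := by
    refine sum_congr rfl fun i _ => ?_
    push_cast
    ring_nf
  rw [e3] at e1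
  rw [e1] at a
  rw [e2] at b
  have := sub_mem (mul_mem_pMultiples four (add_mem a b))
    (mul_mem_pMultiples (add_mem (one_mem _) (inv_four_mem hp3)) hP)
  convert this using 1
  push_cast
  ring

theorem legendreCert_mem {t : ℚ} (ht : t ∈ pIntegral p) {j : ℕ} (hj : j + 1 < p) :
    legendreCert (p * t + (j + 1 : ℕ)) (p - 1) ∈ pMultiples p 2 := by
  set x : ℚ := p * t + (j + 1 : ℕ) with hx
  have hxI : x ∈ pIntegral p := add_mem (mul_mem (natCast_mem _ _) ht) (natCast_mem _ _)
  have e : legendreCert x (p - 1) =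
      (∏ i ∈ range (p - 1), ((x - 1 - i) * ((i : ℚ) + 1)⁻¹)) *
        ∏ i ∈ range (p - 1), ((-1 - x - i) * ((i : ℚ) + 1)⁻¹) := by
    rw [legendreCert, ← prod_mul_distrib]
    refine prod_congr rfl fun i _ => ?_
    have : (i : ℚ) + 1 ≠ 0 := by positivity
    field_simp
  have aux : ∀ (y : ℚ) (m : ℕ), y ∈ pIntegral p → m ∈ range (p - 1) → y - m ∈ pMultiples p 1 →
      ∏ i ∈ range (p - 1), ((y - i) * ((i : ℚ) + 1)⁻¹) ∈ pMultiples p 1 := by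
    intro y m hy hm h
    have hinv : ∀ i ∈ range (p - 1), ((i : ℚ) + 1)⁻¹ ∈ pIntegral p := fun i hi =>
      inv_succ_mem_pIntegral (by have := mem_range.1 hi; omega)
    rw [← mul_prod_erase _ _ hm, mul_comm, mul_comm (y - m), ← mul_assoc]
    refine mul_mem_pMultiples (mul_mem (prod_mem fun i hi => ?_) (hinv m hm)) h
    exact mul_mem (sub_mem hy (natCast_mem _ _)) (hinv i (mem_of_mem_erase hi))
  rw [e]
  refine mul_mem_pMultiples_add (aux _ j (sub_mem hxI (one_mem _)) (by simp; omega) ?_)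
    (aux _ (p - 2 - j) (sub_mem (neg_mem (one_mem _)) hxI) (by simp; omega) ?_)
  · refine ⟨t, ht, ?_⟩
    rw [hx]; push_cast; ring
  · refine ⟨-t - 1, sub_mem (neg_mem ht) (one_mem _), ?_⟩
    have h1 : ((p - 2 - j : ℕ) : ℚ) = p - 2 - j := by
      rw [Nat.cast_sub (by omega), Nat.cast_sub (by omega)]; norm_num
    rw [hx, h1]; push_cast; ring

theorem legendreTerm_prime_mul_congr {t : ℚ} (ht : t ∈ pIntegral p) {k : ℕ} (hk : k + 1 < p) :
    legendreTerm (p * t) (k + 1) + p * t * ((k : ℚ) + 1)⁻¹ ∈ pMultiples p 2 := by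
  have hw : ∀ k, k < p → legendreCert (p * t) k - 1 ∈ pMultiples p 2 := by
    intro k
    induction k with
    | zero => intro _; simp [legendreCert, zero_mem]
    | succ k ih =>
      intro hk
      have ih := ih (by omega)
      have hi := inv_succ_mem_pIntegral (p := p) hk
      have h0 : (k : ℚ) + 1 ≠ 0 := by positivity
      have hf : (p : ℚ) ^ 2 * (t ^ 2 * ((k : ℚ) + 1)⁻¹ ^ 2) ∈ pMultiples p 2 :=
        pow_mul_mem_pMultiples 2 (mul_mem (pow_mem ht 2) (pow_mem hi 2))
      have := sub_mem (mul_mem_pMultiples (sub_mem (one_mem _)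
        (mem_pIntegral_of_mem_pMultiples hf)) ih) hf
      convert this using 1
      rw [legendreCert_succ]
      field_simp
      ring
  have hi := inv_succ_mem_pIntegral (p := p) hk
  have hpI := natCast_mem (pIntegral p) p
  have h0 : (k : ℚ) + 1 ≠ 0 := by positivity
  have hc := hw k (by omega)
  have hkI : ((p : ℚ) * t + k + 1) ∈ pIntegral p :=
    add_mem (add_mem (mul_mem hpI ht) (natCast_mem _ k)) (one_mem _)
  have h1 : -(p * t * (p * t + k + 1) * ((k : ℚ) + 1)⁻¹ ^ 2) *
      (legendreCert (p * t) k - 1) ∈ pMultiples p 2 :=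
    mul_mem_pMultiples (neg_mem (mul_mem (mul_mem (mul_mem hpI ht) hkI) (pow_mem hi 2))) hc
  have h2 : (p : ℚ) ^ 2 * (t ^ 2 * ((k : ℚ) + 1)⁻¹ ^ 2) ∈ pMultiples p 2 :=
    pow_mul_mem_pMultiples 2 (mul_mem (pow_mem ht 2) (pow_mem hi 2))
  have := sub_mem h1 h2
  convert this using 1
  rw [legendreTerm_succ]
  field_simp
  ring

theorem sum_inv_mul_harm_succ (N : ℕ) :
    ∑ k ∈ range N, ((k : ℚ) + 1)⁻¹ * harm (k + 1) = 2⁻¹ * (harm N ^ 2 + harm2 N) := by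
  induction N with
  | zero => simp [harm, harm2]
  | succ N ih =>
    rw [sum_range_succ, ih, harm_succ, harm2, harm2, sum_range_succ]
    have : (N : ℚ) + 1 ≠ 0 := by positivity
    field_simp
    ring

theorem sum_legendreTerm_prime_mul_congr (hp3 : 3 < p) {t : ℚ} (ht : t ∈ pIntegral p) :
    ∑ k ∈ range p, legendreTerm (p * t) k - 1 ∈ pMultiples p 2 ∧
      ∑ k ∈ range p, legendreTerm (p * t) k * harm k ∈ pMultiples p 2 := by
  obtain ⟨h, hh⟩ := (Fact.out : p.Prime).odd_of_ne_two (by omega)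
  have hH := harm_pred_mem hp3 hh
  have hH2 := harm2_pred_mem hp3 hh
  constructor
  · have a : ∑ k ∈ range (2 * h), (legendreTerm (p * t) (k + 1) + p * t * ((k : ℚ) + 1)⁻¹) ∈
        pMultiples p 2 := sum_mem fun k hk =>
      legendreTerm_prime_mul_congr ht (by have := mem_range.1 hk; omega)
    have b := mul_mem_pMultiples ht (prime_mul_mem_pMultiples_succ hH)
    have e : ∑ k ∈ range p, legendreTerm (p * t) k =
        ∑ k ∈ range (2 * h), legendreTerm (p * t) (k + 1) + 1 := by
      rw [← show range (2 * h + 1) = range p by rw [hh], sum_range_succ']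
      simp [legendreTerm]
    have := sub_mem a b
    convert this using 1
    rw [e, sum_add_distrib, ← mul_sum, harm]
    simp only [one_div]
    ring
  · have a : ∑ k ∈ range (2 * h), harm (k + 1) *
        (legendreTerm (p * t) (k + 1) + p * t * ((k : ℚ) + 1)⁻¹) ∈ pMultiples p 2 :=
      sum_mem fun k hk => by
        have hk := mem_range.1 hk
        exact mul_mem_pMultiples (harm_mem (by omega)) (legendreTerm_prime_mul_congr ht (by omega))
    have c : 2⁻¹ * (harm (2 * h) ^ 2 + harm2 (2 * h)) ∈ pMultiples p 1 := by
      refine mul_mem_pMultiples (inv_two_mem hp3) (add_mem ?_ hH2)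
      rw [sq]
      exact mul_mem_pMultiples (mem_pIntegral_of_mem_pMultiples hH) hH
    have b := mul_mem_pMultiples ht (prime_mul_mem_pMultiples_succ c)
    have e : ∑ k ∈ range p, legendreTerm (p * t) k * harm k =
        ∑ k ∈ range (2 * h), legendreTerm (p * t) (k + 1) * harm (k + 1) := by
      rw [← show range (2 * h + 1) = range p by rw [hh], sum_range_succ']
      simp [harm]
    have := sub_mem a b
    convert this using 1
    rw [e, ← sum_inv_mul_harm_succ, mul_sum, mul_sum, ← sum_sub_distrib]
    exact sum_congr rfl fun k _ => by ring

theorem sum_legendreTerm_congr (hp3 : 3 < p) {t : ℚ} (ht : t ∈ pIntegral p)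
    (hinv : ∀ i, i + 1 < p → ((p : ℚ) * t + (i + 1 : ℕ))⁻¹ ∈ pIntegral p ∧
      (p : ℚ) * t + (i + 1 : ℕ) ≠ 0) (n : ℕ) (hn : n < p) :
    ∑ k ∈ range p, legendreTerm (p * t + n) k - (-1) ^ n ∈ pMultiples p 2 ∧
      ∑ k ∈ range p, legendreTerm (p * t + n) k * harm k -
        2 * (-1) ^ n * ∑ i ∈ range n, ((p : ℚ) * t + (i + 1 : ℕ))⁻¹ ∈ pMultiples p 2 := by
  have two : (2 : ℚ) ∈ pIntegral p := by exact_mod_cast natCast_mem (pIntegral p) 2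
  induction n with
  | zero => simpa using sum_legendreTerm_prime_mul_congr hp3 ht
  | succ n ih =>
    obtain ⟨ih1, ih2⟩ := ih (by omega)
    obtain ⟨hxI, hx0⟩ := hinv n hn
    have hw := legendreCert_mem ht hn
    set x : ℚ := p * t + (n + 1 : ℕ) with hx
    have hxs : (p : ℚ) * t + n = x - 1 := by rw [hx]; push_cast; ring
    rw [hxs] at ih1 ih2
    have h1 := sum_legendreTerm_add x (p - 1)
    have h2 := sum_legendreTerm_mul_harm_add hx0 (p - 1)
    rw [Nat.sub_add_cancel (by omega)] at h1 h2
    have hH : harm (p - 1) ∈ pIntegral p := harm_mem (by omega)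
    rw [sum_range_succ, ← hx]
    set S := ∑ k ∈ range p, legendreTerm x k
    set S' := ∑ k ∈ range p, legendreTerm (x - 1) k
    set F := ∑ k ∈ range p, legendreTerm x k * harm k
    set F' := ∑ k ∈ range p, legendreTerm (x - 1) k * harm k
    set W := legendreCert x (p - 1)
    constructor
    · have := sub_mem (mul_mem_pMultiples two hw) ih1
      convert this using 1
      linear_combination h1
    · have := sub_mem (sub_mem (mul_mem_pMultiples (mul_mem two (add_mem hH hxI)) hw)
        (mul_mem_pMultiples (mul_mem two hxI) ih1)) ih2
      convert this using 1
      linear_combination h2 + x⁻¹ * h1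

end Congruences

theorem legendreTerm_neg_one_sub (x : ℚ) (k : ℕ) :
    legendreTerm (-1 - x) k = legendreTerm x k :=
  prod_congr rfl fun j _ => by ring

theorem legendreTerm_neg_one_div_four (k : ℕ) :
    legendreTerm (-1 / 4) k =
      (Nat.choose (4 * k) (2 * k) : ℚ) * (Nat.choose (2 * k) k) / 64 ^ k := by
  have e : ∀ k : ℕ, (Nat.choose (4 * k) (2 * k) : ℚ) * (Nat.choose (2 * k) k) =
      (4 * k).factorial / ((2 * k).factorial * (k.factorial) ^ 2) := by
    intro k
    rw [Nat.cast_choose ℚ (by omega), Nat.cast_choose ℚ (by omega),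
      show 4 * k - 2 * k = 2 * k by omega, show 2 * k - k = k by omega]
    have := Nat.factorial_ne_zero (2 * k)
    have := Nat.factorial_ne_zero k
    field_simp
  rw [e]
  induction k with
  | zero => simp [legendreTerm]
  | succ k ih =>
    rw [legendreTerm, prod_range_succ, ← legendreTerm, ih,
      show 4 * (k + 1) = 4 * k + 1 + 1 + 1 + 1 by ring, show 2 * (k + 1) = 2 * k + 1 + 1 by ring]
    simp only [Nat.factorial_succ]
    push_cast
    have h1 : ((2 * k).factorial : ℚ) ≠ 0 := by exact_mod_cast Nat.factorial_ne_zero _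
    have h2 : (k.factorial : ℚ) ≠ 0 := by exact_mod_cast Nat.factorial_ne_zero _
    field_simp
    ring

theorem stmt_7 (p : ℕ) (hp : p.Prime) (hp3 : 3 < p) :
    CongrMod p 2
      ((if p % 8 = 1 ∨ p % 8 = 3 then (1 : ℚ) else -1) *
        ∑ k ∈ Finset.range p,
          (Nat.choose (4 * k) (2 * k) : ℚ) * (Nat.choose (2 * k) k) / 64 ^ k * harm k)
      (-6 * (((2 : ℚ) ^ (p - 1) - 1) / p) +
        3 * p * (((2 : ℚ) ^ (p - 1) - 1) / p) ^ 2) := by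
  have : Fact p.Prime := ⟨hp⟩
  obtain ⟨h, hh⟩ := hp.odd_of_ne_two (by omega)
  apply congrMod_of_sub_mem
  have ht : (-4⁻¹ : ℚ) ∈ pIntegral p := neg_mem (inv_four_mem hp3)
  have three : (3 : ℚ) ∈ pIntegral p := by exact_mod_cast natCast_mem (pIntegral p) 3
  have four : (4 : ℚ) ∈ pIntegral p := by exact_mod_cast natCast_mem (pIntegral p) 4
  have hinv (i : ℕ) (hi : i + 1 < p) :
      ((p : ℚ) * -4⁻¹ + (i + 1 : ℕ))⁻¹ = -4 * ((p : ℚ) - 4 * ((i : ℚ) + 1))⁻¹ := by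
    rw [show (p : ℚ) * -4⁻¹ + (i + 1 : ℕ) = -4⁻¹ * ((p : ℚ) - 4 * ((i : ℚ) + 1)) by
      push_cast; ring, mul_inv]
    norm_num
  have hmain := (sum_legendreTerm_congr hp3 ht (fun i hi => by
    have h1 := inv_sub_mul_mem (p := p) (k := 4) (Nat.succ_pos i) hi (by omega) (by omega)
    have h2 := sub_mul_ne_zero (p := p) (k := 4) (Nat.succ_pos i) hi (by omega) (by omega)
    push_cast at h1 h2
    constructor
    · rw [hinv i hi]
      exact mul_mem (neg_mem four) h1
    · intro h0
      apply h2
      push_cast at h0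
      linear_combination -4 * h0) (p / 4) (by omega)).2
  rw [sum_congr rfl fun i hi => hinv i (by have := mem_range.1 hi; omega), ← mul_sum] at hmain
  have hterm (k : ℕ) : legendreTerm ((p : ℚ) * -4⁻¹ + (p / 4 : ℕ)) k =
      (Nat.choose (4 * k) (2 * k) : ℚ) * (Nat.choose (2 * k) k) / 64 ^ k := by
    rw [← legendreTerm_neg_one_div_four]
    obtain h4 | h4 : p = 4 * (p / 4) + 1 ∨ p = 4 * (p / 4) + 3 := by omega
    · have h5 : (p : ℚ) = 4 * (p / 4 : ℕ) + 1 := by exact_mod_cast h4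
      congr 1
      linear_combination -(1 / 4) * h5
    · have h5 : (p : ℚ) = 4 * (p / 4 : ℕ) + 3 := by exact_mod_cast h4
      rw [← legendreTerm_neg_one_sub]
      congr 1
      linear_combination (1 / 4) * h5
  simp only [hterm] at hmain
  have hsign : (if p % 8 = 1 ∨ p % 8 = 3 then (1 : ℚ) else -1) = (-1) ^ (p / 4) := by
    split_ifs with hc
    · exact (Even.neg_one_pow (Nat.even_iff.2 (by omega))).symm
    · exact (Odd.neg_one_pow (Nat.odd_iff.2 (by omega))).symm
  rw [hsign]
  have hsq : ((-1 : ℚ) ^ (p / 4)) * (-1) ^ (p / 4) = 1 := by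
    rw [← mul_pow]; norm_num
  have hs : ((-1 : ℚ) ^ (p / 4)) ∈ pIntegral p := pow_mem (neg_mem (one_mem _)) _
  have := add_mem (sub_mem (mul_mem_pMultiples hs hmain) (sum_inv_sub_four_mul_congr hp3 hh))
    (mul_mem_pMultiples three (harm_half_congr hp3 hh))
  convert this using 1
  linear_combination (-8 * ∑ i ∈ range (p / 4), ((p : ℚ) - 4 * ((i : ℚ) + 1))⁻¹) * hsq
end

section
/- Let p > 3 be a prime, let a be a rational number whose denominator is coprime to p, and let m be a positive integer with a ≡ m (mod p²). Then (2a-1)·Σ_{k=0}^{p-1} C(-a,k)·C(a-1,k)·H_k^{(2)}/(2k+1) ≡ -2·Σ_{0<k<m, p∤k} 1/k² ≡ (2-2p)·B_{p²-p-1}(a) (mod p²). -/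
open Finset

/-! ### The ring of `p`-integral rationals -/

/-- The ring of rational numbers whose denominator is prime to `p`. -/
noncomputable def pIntegers (p : ℕ) [Fact p.Prime] : Subring ℚ :=
  (Rat.padicValuation p).integer

/-- The fractional ideal `p ^ n` of the ring of `p`-integral rationals. -/
noncomputable def primePow (p : ℕ) [Fact p.Prime] (n : ℕ) : Submodule (pIntegers p) ℚ :=
  Submodule.span (pIntegers p) {(p : ℚ) ^ n}

lemma sum_filter_Ico_inv_sq (p m : ℕ) :
    ∑ k ∈ (Ico 1 m).filter (fun k => ¬ (p ∣ k)), (1 : ℚ) / (k : ℚ) ^ 2 =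
      ∑ k ∈ range m, if p ∣ k then 0 else (1 : ℚ) / (k : ℚ) ^ 2 := by
  rw [sum_filter, range_eq_Ico]
  rcases m.eq_zero_or_pos with rfl | hm
  · simp
  rw [sum_eq_sum_Ico_succ_bot hm]
  simp [ite_not]

section

variable {p : ℕ} [Fact p.Prime]

lemma mem_pIntegers {x : ℚ} : x ∈ pIntegers p ↔ ¬ p ∣ x.den := by
  rw [pIntegers, Valuation.mem_integer_iff, Rat.padicValuation_le_one_iff]

lemma mem_primePow {n : ℕ} {x : ℚ} :
    x ∈ primePow p n ↔ ∃ z ∈ pIntegers p, z * (p : ℚ) ^ n = x := by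
  simp [primePow, Submodule.mem_span_singleton, Subring.smul_def]

lemma mul_mem_primePow {n : ℕ} {x y : ℚ} (hx : x ∈ pIntegers p) (hy : y ∈ primePow p n) :
    x * y ∈ primePow p n :=
  (primePow p n).smul_mem ⟨x, hx⟩ hy

lemma congrMod_iff {n : ℕ} {x y : ℚ} : CongrMod p n x y ↔ x - y ∈ primePow p n := by
  have hp : (p : ℚ) ≠ 0 := mod_cast (Fact.out : p.Prime).ne_zero
  rcases eq_or_ne x y with rfl | hxy
  · simp [CongrMod]
  have h0 : x - y ≠ 0 := sub_ne_zero.2 hxy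
  have hq : (x - y) / (p : ℚ) ^ n ≠ 0 := div_ne_zero h0 (pow_ne_zero _ hp)
  have key : x - y ∈ primePow p n ↔ (x - y) / (p : ℚ) ^ n ∈ pIntegers p := by
    rw [mem_primePow]
    constructor
    · rintro ⟨z, hz, h⟩
      rwa [← h, mul_div_cancel_right₀ _ (pow_ne_zero _ hp)]
    · exact fun h => ⟨_, h, div_mul_cancel₀ _ (pow_ne_zero _ hp)⟩
  rw [key, pIntegers, Valuation.mem_integer_iff]
  simp only [CongrMod, hxy, false_or, Rat.padicValuation]
  change _ ↔ (if _ then _ else _) ≤ _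
  rw [if_neg hq, padicValRat.div h0 (pow_ne_zero _ hp), padicValRat.pow, padicValRat.self
    (Fact.out : p.Prime).one_lt]
  rw [← WithZero.exp_zero, WithZero.exp_le_exp]
  constructor <;> intro h <;> linarith

lemma intCast_mem_primePow {n : ℕ} {k : ℤ} :
    (k : ℚ) ∈ primePow p n ↔ ((p ^ n : ℕ) : ℤ) ∣ k := by
  have hp : (p : ℚ) ≠ 0 := mod_cast (Fact.out : p.Prime).ne_zero
  constructor
  · intro h
    have h' : CongrMod p n (k : ℚ) 0 := congrMod_iff.2 (by simpa using h)
    rcases h' with h' | h'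
    · simp [show k = 0 by exact_mod_cast h']
    · rw [sub_zero, padicValRat.of_int] at h'
      rw [Nat.cast_pow, padicValInt_dvd_iff]
      right; exact_mod_cast h'
  · rintro ⟨c, rfl⟩
    refine mem_primePow.2 ⟨c, intCast_mem _ c, ?_⟩
    push_cast; ring

lemma inv_natCast_mem_pIntegers {k : ℕ} (hk : ¬ p ∣ k) : ((k : ℚ))⁻¹ ∈ pIntegers p := by
  rw [mem_pIntegers, Rat.inv_natCast_den]
  split_ifs with h
  · exact (Fact.out : p.Prime).one_lt.ne' ∘ Nat.dvd_one.1
  · exact hk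

lemma exists_natCast_sub_mem_primePow {x : ℚ} (hx : x ∈ pIntegers p) (n : ℕ) :
    ∃ k : ℕ, x - k ∈ primePow p n := by
  have hcop : IsCoprime (x.den : ℤ) ((p ^ n : ℕ) : ℤ) := Nat.isCoprime_iff_coprime.2
    (Nat.Coprime.pow_right _ ((Nat.Prime.coprime_iff_not_dvd Fact.out).2
      (mem_pIntegers.1 hx)).symm)
  obtain ⟨u, v, huv⟩ := hcop
  have hpn : ((p ^ n : ℕ) : ℤ) ≠ 0 := mod_cast (pow_pos (Fact.out : p.Prime).pos n).ne'
  refine ⟨((x.num * u) % ((p ^ n : ℕ) : ℤ)).toNat, ?_⟩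
  have h1 : (((x.num * u) % ((p ^ n : ℕ) : ℤ)).toNat : ℤ) = (x.num * u) % ((p ^ n : ℕ) : ℤ) :=
    Int.toNat_of_nonneg (Int.emod_nonneg _ hpn)
  have h2 : (((x.num * u) % ((p ^ n : ℕ) : ℤ)).toNat : ℚ) =
      x.num * u - (p : ℚ) ^ n * ((x.num * u / ((p ^ n : ℕ) : ℤ) : ℤ) : ℚ) := by
    have := Int.emod_add_mul_ediv (x.num * u) ((p ^ n : ℕ) : ℤ)
    rw [← h1] at this
    have h3 := congrArg (Int.cast : ℤ → ℚ) this
    push_cast at h3 ⊢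
    linarith
  have h3 : (u : ℚ) * x.den + v * (p : ℚ) ^ n = 1 := by exact_mod_cast huv
  refine mem_primePow.2 ⟨x * v + ((x.num * u / ((p ^ n : ℕ) : ℤ) : ℤ) : ℚ),
    add_mem (mul_mem hx (intCast_mem _ _)) (intCast_mem _ _), ?_⟩
  rw [h2, ← Rat.mul_den_eq_num x]
  linear_combination x * h3

/-! ### Polynomials with `p`-integral coefficients -/

/-- The ring of rational polynomials with `p`-integral coefficients. -/
noncomputable def pIntegralPoly (p : ℕ) [Fact p.Prime] : Subring (Polynomial ℚ) :=
  Polynomial.liftsRing (pIntegers p).subtype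

lemma mem_pIntegralPoly {Q : Polynomial ℚ} :
    Q ∈ pIntegralPoly p ↔ ∀ i, Q.coeff i ∈ pIntegers p := by
  rw [pIntegralPoly, ← Polynomial.lifts_iff_liftsRing, Polynomial.lifts_iff_coeff_lifts]
  simp

lemma C_mem_pIntegralPoly {c : ℚ} (hc : c ∈ pIntegers p) :
    Polynomial.C c ∈ pIntegralPoly p := by
  rw [pIntegralPoly, ← Polynomial.lifts_iff_liftsRing]
  exact Polynomial.C_mem_lifts (pIntegers p).subtype ⟨c, hc⟩

lemma X_mem_pIntegralPoly : Polynomial.X ∈ pIntegralPoly p := by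
  rw [pIntegralPoly, ← Polynomial.lifts_iff_liftsRing]
  exact Polynomial.X_mem_lifts _

lemma eval_sub_eval_mem_primePow {Q : Polynomial ℚ} {n : ℕ} {x y : ℚ}
    (hQ : Polynomial.C (p : ℚ) * Q ∈ pIntegralPoly p) (hx : x ∈ pIntegers p)
    (hy : y ∈ pIntegers p) (hxy : x - y ∈ primePow p (n + 1)) :
    Q.eval x - Q.eval y ∈ primePow p n := by
  have hp : (p : ℚ) ≠ 0 := mod_cast (Fact.out : p.Prime).ne_zero
  rw [pIntegralPoly, ← Polynomial.lifts_iff_liftsRing, Polynomial.mem_lifts] at hQ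
  obtain ⟨q, hq⟩ := hQ
  have hev : ∀ z : pIntegers p, (p : ℚ) * Q.eval (z : ℚ) = ((q.eval z : pIntegers p) : ℚ) := by
    intro z
    have := congrArg (Polynomial.eval (z : ℚ)) hq
    rw [Polynomial.eval_mul, Polynomial.eval_C] at this
    rw [← this]
    exact Polynomial.eval_map_apply (f := (pIntegers p).subtype) z
  obtain ⟨c, hc⟩ := Polynomial.sub_dvd_eval_sub (⟨x, hx⟩ : pIntegers p) ⟨y, hy⟩ q
  have hc' := congrArg (Subtype.val) hc
  push_cast at hc'
  rw [← hev, ← hev] at hc'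
  obtain ⟨z, hz, h⟩ := mem_primePow.1 hxy
  refine mem_primePow.2 ⟨z * c, mul_mem hz c.2, ?_⟩
  apply mul_left_cancel₀ hp
  linear_combination c * h - hc'

lemma natCast_mul_bernoulli_mem_pIntegers (hp2 : p ≠ 2) (n : ℕ) :
    (p : ℚ) * bernoulli n ∈ pIntegers p := by
  have hp : p.Prime := Fact.out
  have hp0 : (p : ℚ) ≠ 0 := mod_cast hp.ne_zero
  rcases n.even_or_odd with heven | hodd
  · obtain ⟨k, rfl⟩ := heven.two_dvd
    obtain ⟨z, hz⟩ := Bernoulli.vonStaudt_clausen k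
    rw [eq_sub_of_add_eq hz.symm, mul_sub, mul_sum]
    refine sub_mem (mul_mem (natCast_mem _ _) (intCast_mem _ _)) (sum_mem fun q hq => ?_)
    rw [mem_filter] at hq
    by_cases hqp : q = p
    · subst hqp
      rw [mul_one_div_cancel hp0]
      exact one_mem _
    · rw [one_div]
      exact mul_mem (natCast_mem _ _) (inv_natCast_mem_pIntegers
        (fun h => hqp ((Nat.prime_dvd_prime_iff_eq hp hq.2.1).1 h).symm))
  · rcases eq_or_ne n 1 with rfl | h1
    · have h2 := inv_natCast_mem_pIntegers (p := p) (k := 2)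
        (fun h => hp2 ((Nat.prime_dvd_prime_iff_eq hp Nat.prime_two).1 h))
      rw [bernoulli_one]
      have := mul_mem (natCast_mem (pIntegers p) p) (neg_mem h2)
      convert this using 2
      norm_num
    · rw [bernoulli_eq_zero_of_odd hodd (by have := hodd.pos; omega), mul_zero]
      exact zero_mem _

lemma C_mul_bernoulli_mem_pIntegralPoly (hp2 : p ≠ 2) (n : ℕ) :
    Polynomial.C (p : ℚ) * Polynomial.bernoulli n ∈ pIntegralPoly p := by
  rw [mem_pIntegralPoly]
  intro i
  rw [Polynomial.coeff_C_mul, Polynomial.coeff_bernoulli]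
  split_ifs
  · rw [← mul_assoc]
    exact mul_mem (natCast_mul_bernoulli_mem_pIntegers hp2 _) (natCast_mem _ _)
  · simp

/-! ### Sums of inverse squares and power sums -/

lemma sq_sub_sub_two_add_two (hp3 : 3 < p) : p ^ 2 - p - 2 + 2 = Nat.totient (p ^ 2) := by
  have : p * 4 ≤ p * p := Nat.mul_le_mul_left _ hp3
  rw [Nat.totient_prime_pow Fact.out two_pos, show 2 - 1 = 1 from rfl, pow_one, Nat.mul_sub,
    mul_one, pow_two]
  omega

lemma sum_inv_sq_sub_sum_pow_mem (hp3 : 3 < p) (m : ℕ) :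
    (∑ k ∈ range m, if p ∣ k then 0 else (1 : ℚ) / (k : ℚ) ^ 2) -
      ∑ k ∈ range m, (k : ℚ) ^ (p ^ 2 - p - 2) ∈ primePow p 2 := by
  have hp : p.Prime := Fact.out
  have he := sq_sub_sub_two_add_two hp3
  have he2 : 2 ≤ p ^ 2 - p - 2 := by
    have : p * 4 ≤ p * p := Nat.mul_le_mul_left _ hp3
    rw [pow_two]; omega
  rw [← sum_sub_distrib]
  refine sum_mem fun k _ => ?_
  split_ifs with hk
  · obtain ⟨c, rfl⟩ := hk
    have : (((-(p * c : ℕ) ^ (p ^ 2 - p - 2) : ℤ)) : ℚ) ∈ primePow p 2 := by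
      rw [intCast_mem_primePow, dvd_neg]
      exact_mod_cast (pow_dvd_pow_of_dvd (dvd_mul_right p c) 2).trans (pow_dvd_pow _ he2)
    simpa using this
  · have hk0 : (k : ℚ) ≠ 0 := by rintro h; simp [show k = 0 by exact_mod_cast h] at hk
    have h1 : (((1 - (k : ℤ) ^ Nat.totient (p ^ 2) : ℤ)) : ℚ) ∈ primePow p 2 := by
      rw [intCast_mem_primePow]
      have := Nat.ModEq.pow_totient (Nat.Coprime.pow_right 2
        ((Nat.Prime.coprime_iff_not_dvd hp).2 hk).symm)
      exact_mod_cast (Nat.modEq_iff_dvd).1 this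
    have := mul_mem_primePow (pow_mem (inv_natCast_mem_pIntegers hk) 2) h1
    convert this using 1
    rw [← he]
    push_cast
    field_simp
    ring

lemma sum_range_natCast_zmod {M : Type*} [AddCommMonoid M] (n : ℕ) [NeZero n] (g : ZMod n → M) :
    ∑ k ∈ range n, g k = ∑ x, g x := by
  refine sum_nbij (fun k => (k : ZMod n)) (by simp) ?_ ?_ (by simp)
  · intro i hi j hj hij
    have := (ZMod.natCast_eq_natCast_iff' _ _ _).1 hij
    rwa [Nat.mod_eq_of_lt (by simpa using hi), Nat.mod_eq_of_lt (by simpa using hj)] at this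
  · intro x _
    exact ⟨x.val, by simpa using x.val_lt, by simp⟩

lemma sum_zmod_pow_eq_zero (hp3 : 3 < p) :
    ∑ x : ZMod (p ^ 2), x ^ (p ^ 2 - p - 2) = 0 := by
  have hp : p.Prime := Fact.out
  have he := sq_sub_sub_two_add_two hp3
  have h2 : Nat.Coprime 2 (p ^ 2) := Nat.Coprime.pow_right 2
    ((Nat.coprime_primes Nat.prime_two hp).2 (by omega))
  have h3 : Nat.Coprime 3 (p ^ 2) := Nat.Coprime.pow_right 2
    ((Nat.coprime_primes Nat.prime_three hp).2 (by omega))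
  set S := ∑ x : ZMod (p ^ 2), x ^ (p ^ 2 - p - 2) with hS
  have hmul : S = 2 ^ (p ^ 2 - p - 2) * S := by
    rw [hS, mul_sum, ← Equiv.sum_comp (Units.mulLeft (ZMod.unitOfCoprime 2 h2))]
    refine sum_congr rfl fun x _ => ?_
    simp [mul_pow]
  have hpow : (2 : ZMod (p ^ 2)) ^ Nat.totient (p ^ 2) = 1 := by
    have := congrArg Units.val (ZMod.pow_totient (ZMod.unitOfCoprime 2 h2))
    rw [Units.val_pow_eq_pow_val, ZMod.coe_unitOfCoprime] at this
    exact_mod_cast this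
  have h3S : ((3 : ℕ) : ZMod (p ^ 2)) * S = 0 := by
    rw [← he, pow_add] at hpow
    push_cast
    linear_combination 4 * hmul + S * hpow
  exact (((ZMod.isUnit_iff_coprime 3 (p ^ 2)).2 h3).mul_right_eq_zero).1 h3S

lemma sum_pow_add_sub_sum_pow_mem (hp3 : 3 < p) (m t : ℕ) :
    (∑ k ∈ range (m + p ^ 2 * t), (k : ℚ) ^ (p ^ 2 - p - 2)) -
      ∑ k ∈ range m, (k : ℚ) ^ (p ^ 2 - p - 2) ∈ primePow p 2 := by
  have hp : p.Prime := Fact.out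
  have : NeZero (p ^ 2) := ⟨pow_ne_zero _ hp.ne_zero⟩
  induction t with
  | zero => simp
  | succ t ih =>
    have hd (s : ℕ) : ((∑ k ∈ range (p ^ 2), ((s + k : ℕ) : ℤ) ^ (p ^ 2 - p - 2) : ℤ) : ℚ)
        ∈ primePow p 2 := by
      rw [intCast_mem_primePow, ← ZMod.intCast_zmod_eq_zero_iff_dvd]
      push_cast
      rw [sum_range_natCast_zmod (p ^ 2) (fun x => ((s : ZMod (p ^ 2)) + x) ^ (p ^ 2 - p - 2)),
        ← sum_zmod_pow_eq_zero hp3]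
      exact (Equiv.addLeft (s : ZMod (p ^ 2))).bijective.sum_comp (fun x => x ^ (p ^ 2 - p - 2))
    rw [mul_add, mul_one, ← add_assoc, sum_range_add]
    convert add_mem ih (hd (m + p ^ 2 * t)) using 1
    push_cast
    ring

/-! ### The sum as a function of its parameter -/

/-- The sum `(2x - 1) ∑_{k < n} C(-x, k) C(x - 1, k) H_k^{(2)} / (2k + 1)`. -/
noncomputable def binomHarmSum (n : ℕ) (x : ℚ) : ℚ :=
  (2 * x - 1) *
    ∑ k ∈ range n, gchoose (-x) k * gchoose (x - 1) k * harm2 k / (2 * k + 1)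

lemma gchoose_mul_gchoose_shift {x : ℚ} (hx : x ≠ 0) (k : ℕ) :
    (2 * (x + 1) - 1) * (gchoose (-(x + 1)) k * gchoose (x + 1 - 1) k) -
      (2 * x - 1) * (gchoose (-x) k * gchoose (x - 1) k) =
      2 * (2 * k + 1) * ((∏ j ∈ range k, ((j : ℚ) ^ 2 - x ^ 2)) / (k.factorial : ℚ) ^ 2) := by
  have hV : x * ∏ j ∈ range k, (x - 1 - j) = (∏ j ∈ range k, (x + 1 - 1 - j)) * (x - k) := by
    induction k with
    | zero => simp
    | succ k ih =>
      rw [prod_range_succ, prod_range_succ, ← mul_assoc, ih]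
      push_cast; ring
  have hW : x * ∏ j ∈ range k, (-(x + 1) - j) = (∏ j ∈ range k, (-x - j)) * (x + k) := by
    clear hV
    induction k with
    | zero => simp
    | succ k ih =>
      rw [prod_range_succ, prod_range_succ, ← mul_assoc, ih]
      push_cast; ring
  have hD : ∏ j ∈ range k, ((j : ℚ) ^ 2 - x ^ 2) =
      (∏ j ∈ range k, (-x - j)) * ∏ j ∈ range k, (x + 1 - 1 - j) := by
    rw [← prod_mul_distrib]
    exact prod_congr rfl fun j _ => by ring
  have hk : (k.factorial : ℚ) ≠ 0 := mod_cast k.factorial_ne_zero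
  rw [hD, gchoose, gchoose, gchoose, gchoose]
  generalize ∏ j ∈ range k, (x - 1 - j) = V at *
  generalize ∏ j ∈ range k, (-(x + 1) - j) = W at *
  generalize ∏ j ∈ range k, (x + 1 - 1 - j) = Z at *
  generalize ∏ j ∈ range k, (-x - j) = U at *
  field_simp
  apply mul_left_cancel₀ hx
  linear_combination (2 * (x + 1) - 1) * Z * hW - (2 * x - 1) * U * hV

lemma binomHarmSum_add_one_sub {x : ℚ} (hx : x ≠ 0) (n : ℕ) :
    binomHarmSum n (x + 1) - binomHarmSum n x =
      2 * ∑ k ∈ range n,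
        harm2 k * ((∏ j ∈ range k, ((j : ℚ) ^ 2 - x ^ 2)) / (k.factorial : ℚ) ^ 2) := by
  rw [binomHarmSum, binomHarmSum, mul_sum, mul_sum, mul_sum, ← sum_sub_distrib]
  refine sum_congr rfl fun k _ => ?_
  have hk : (2 * (k : ℚ) + 1) ≠ 0 := by positivity
  have h := gchoose_mul_gchoose_shift hx k
  generalize (∏ j ∈ range k, ((j : ℚ) ^ 2 - x ^ 2)) / (k.factorial : ℚ) ^ 2 = D at *
  rw [mul_div_assoc', mul_div_assoc', ← sub_div, div_eq_iff hk]
  linear_combination harm2 k * h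

lemma prod_sq_sub_sq_div_factorial_sq (x : ℚ) (k : ℕ) :
    (∏ j ∈ range (k + 1), ((j : ℚ) ^ 2 - x ^ 2)) / ((k + 1).factorial : ℚ) ^ 2 =
      -(x ^ 2 / ((k : ℚ) + 1) ^ 2) * ∏ j ∈ range k, (1 - x ^ 2 / ((j : ℚ) + 1) ^ 2) := by
  induction k with
  | zero => simp
  | succ k ih =>
    have hk : ((k + 1).factorial : ℚ) ≠ 0 := mod_cast (k + 1).factorial_ne_zero
    have h1 : (k : ℚ) + 1 ≠ 0 := by positivity
    have h2 : (k : ℚ) + 1 + 1 ≠ 0 := by positivity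
    rw [div_eq_iff (pow_ne_zero _ hk)] at ih
    rw [prod_range_succ _ (k + 1), ih, prod_range_succ _ k, Nat.factorial_succ (k + 1)]
    push_cast
    field_simp

lemma sum_harm2_mul_prod (x : ℚ) (n : ℕ) :
    x ^ 2 * ∑ k ∈ range (n + 1),
        harm2 k * ((∏ j ∈ range k, ((j : ℚ) ^ 2 - x ^ 2)) / (k.factorial : ℚ) ^ 2) =
      (x ^ 2 * harm2 n + 1) * ∏ j ∈ range n, (1 - x ^ 2 / ((j : ℚ) + 1) ^ 2) - 1 := by
  induction n with
  | zero => simp [harm2]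
  | succ n ih =>
    have h : harm2 (n + 1) = harm2 n + 1 / ((n : ℚ) + 1) ^ 2 := by
      rw [harm2, sum_range_succ, ← harm2]
    have h1 : (n : ℚ) + 1 ≠ 0 := by positivity
    rw [sum_range_succ, mul_add, ih, prod_sq_sub_sq_div_factorial_sq, prod_range_succ, h]
    field_simp
    ring

lemma binomHarmSum_one (n : ℕ) : binomHarmSum n 1 = 0 := by
  rw [binomHarmSum, sum_eq_zero, mul_zero]
  intro k _
  rcases k with _ | k
  · simp [harm2]
  · simp [gchoose, prod_range_succ']

lemma inv_succ_mem_pIntegers {j : ℕ} (hj : j + 1 < p) : (((j : ℚ) + 1))⁻¹ ∈ pIntegers p := by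
  have := inv_natCast_mem_pIntegers (p := p) (Nat.not_dvd_of_pos_of_lt j.succ_pos hj)
  exact_mod_cast this

lemma harm2_mem_pIntegers {k : ℕ} (hk : k < p) : harm2 k ∈ pIntegers p := by
  refine sum_mem fun j hj => ?_
  rw [one_div, ← inv_pow]
  exact pow_mem (inv_succ_mem_pIntegers (by have := mem_range.1 hj; omega)) 2

lemma prod_one_sub_mem_pIntegers {x : ℚ} (hx : x ∈ pIntegers p) {k : ℕ} (hk : k < p) :
    ∏ j ∈ range k, (1 - x ^ 2 / ((j : ℚ) + 1) ^ 2) ∈ pIntegers p := by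
  refine prod_mem fun j hj => sub_mem (one_mem _) ?_
  rw [div_eq_mul_inv, ← inv_pow]
  exact mul_mem (pow_mem hx 2)
    (pow_mem (inv_succ_mem_pIntegers (by have := mem_range.1 hj; omega)) 2)

lemma prod_one_sub_mem_primePow {m : ℕ} (hm : ¬ p ∣ m) :
    ∏ j ∈ range (p - 1), (1 - (m : ℚ) ^ 2 / ((j : ℚ) + 1) ^ 2) ∈ primePow p 2 := by
  have hp : p.Prime := Fact.out
  have hr : 0 < m % p := Nat.pos_of_ne_zero fun h => hm (Nat.dvd_of_mod_eq_zero h)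
  have hlt : m % p < p := Nat.mod_lt _ hp.pos
  have hdm : ((m % p : ℕ) : ℤ) + p * ((m / p : ℕ) : ℤ) = m := mod_cast Nat.mod_add_div m p
  have h1 : (p : ℤ) ∣ ∏ j ∈ range (p - 1), ((j : ℤ) + 1 - m) := by
    refine Dvd.dvd.trans ?_ (dvd_prod_of_mem _
      (show m % p - 1 ∈ range (p - 1) by rw [mem_range]; omega))
    refine ⟨-((m / p : ℕ) : ℤ), ?_⟩
    rw [Nat.cast_sub hr]
    push_cast at hdm ⊢
    linarith
  have h2 : (p : ℤ) ∣ ∏ j ∈ range (p - 1), ((j : ℤ) + 1 + m) := by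
    refine Dvd.dvd.trans ?_ (dvd_prod_of_mem _
      (show p - m % p - 1 ∈ range (p - 1) by rw [mem_range]; omega))
    refine ⟨1 + ((m / p : ℕ) : ℤ), ?_⟩
    rw [Nat.cast_sub (by omega), Nat.cast_sub hlt.le]
    push_cast at hdm ⊢
    linarith
  have h3 : (((∏ j ∈ range (p - 1), ((j : ℤ) + 1 - m)) *
      ∏ j ∈ range (p - 1), ((j : ℤ) + 1 + m) : ℤ) : ℚ) ∈ primePow p 2 := by
    rw [intCast_mem_primePow]
    push_cast
    rw [pow_two]
    exact mul_dvd_mul h1 h2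
  have h4 : ∏ j ∈ range (p - 1), (((j : ℚ) + 1)⁻¹) ^ 2 ∈ pIntegers p :=
    prod_mem fun j hj => pow_mem (inv_succ_mem_pIntegers (by have := mem_range.1 hj; omega)) 2
  convert mul_mem_primePow h4 h3 using 1
  push_cast
  rw [← prod_mul_distrib, ← prod_mul_distrib]
  refine prod_congr rfl fun j _ => ?_
  have : (j : ℚ) + 1 ≠ 0 := by positivity
  field_simp
  ring

lemma binomHarmSum_natCast_succ_sub_mem {m : ℕ} (hm : 0 < m) :
    binomHarmSum p (m + 1) - binomHarmSum p m +
      2 * (if p ∣ m then 0 else (1 : ℚ) / (m : ℚ) ^ 2) ∈ primePow p 2 := by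
  have hp : p.Prime := Fact.out
  have hm0 : (m : ℚ) ≠ 0 := by positivity
  have h2 : (2 : ℚ) ∈ pIntegers p := ofNat_mem _ 2
  rw [binomHarmSum_add_one_sub hm0, ← mul_add]
  refine mul_mem_primePow h2 ?_
  split_ifs with h
  · rw [add_zero]
    refine sum_mem fun k hk => ?_
    rw [mem_range] at hk
    rcases k with _ | k
    · simp [harm2]
    rw [prod_sq_sub_sq_div_factorial_sq]
    have hm2 : (m : ℚ) ^ 2 ∈ primePow p 2 := by
      have : (((m ^ 2 : ℕ) : ℤ) : ℚ) ∈ primePow p 2 := by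
        rw [intCast_mem_primePow]
        exact_mod_cast pow_dvd_pow_of_dvd h 2
      exact_mod_cast this
    have := mul_mem_primePow (mul_mem (mul_mem (harm2_mem_pIntegers hk)
      (neg_mem (pow_mem (inv_succ_mem_pIntegers hk) 2)))
      (prod_one_sub_mem_pIntegers (natCast_mem _ m) (k.lt_succ_self.trans hk))) hm2
    convert this using 1
    rw [inv_pow]
    ring
  · have key := sum_harm2_mul_prod m (p - 1)
    rw [Nat.sub_add_cancel hp.one_le] at key
    have := mul_mem_primePow (add_mem (harm2_mem_pIntegers (Nat.sub_lt hp.pos one_pos))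
      (pow_mem (inv_natCast_mem_pIntegers h) 2)) (prod_one_sub_mem_primePow h)
    convert this using 1
    apply mul_left_cancel₀ (pow_ne_zero 2 hm0)
    rw [mul_add, key]
    field_simp
    ring

lemma binomHarmSum_natCast_mem {m : ℕ} (hm : 0 < m) :
    binomHarmSum p m + 2 * ∑ k ∈ range m, (if p ∣ k then 0 else (1 : ℚ) / (k : ℚ) ^ 2) ∈
      primePow p 2 := by
  induction m, hm using Nat.le_induction with
  | base => simp [binomHarmSum_one]
  | succ m hm ih =>
    rw [sum_range_succ, Nat.cast_succ]
    convert add_mem ih (binomHarmSum_natCast_succ_sub_mem (p := p) hm) using 1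
    ring

lemma natCast_div_two_mul_add_one_mem {k : ℕ} (hk : k < p) :
    (p : ℚ) / (2 * k + 1) ∈ pIntegers p := by
  by_cases h : p ∣ 2 * k + 1
  · obtain ⟨c, hc⟩ := h
    have hc1 : c = 1 := by
      have h0 : c ≠ 0 := by rintro rfl; simp at hc
      have h1 : c < 2 := by by_contra! h2; have := Nat.mul_le_mul_left p h2; omega
      omega
    have : (2 * k + 1 : ℚ) = p := by rw [hc1, mul_one] at hc; exact_mod_cast hc
    rw [this, div_self (mod_cast (Fact.out : p.Prime).ne_zero)]
    exact one_mem _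
  · have := mul_mem (natCast_mem (pIntegers p) p) (inv_natCast_mem_pIntegers h)
    rw [div_eq_mul_inv]
    exact_mod_cast this

lemma exists_eval_eq_binomHarmSum (p : ℕ) [Fact p.Prime] :
    ∃ Q : Polynomial ℚ, Polynomial.C (p : ℚ) * Q ∈ pIntegralPoly p ∧
      ∀ x, Q.eval x = binomHarmSum p x := by
  open Polynomial in
  refine ⟨(C 2 * X - C 1) * ∑ k ∈ range p,
    C (harm2 k / (2 * k + 1) * ((k.factorial : ℚ)⁻¹) ^ 2) *
      ((∏ j ∈ range k, (-X - C (j : ℚ))) * ∏ j ∈ range k, (X - C 1 - C (j : ℚ))), ?_, ?_⟩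
  · rw [mul_left_comm, mul_sum]
    have hX := X_mem_pIntegralPoly (p := p)
    have hC (n : ℕ) : C (n : ℚ) ∈ pIntegralPoly p := C_mem_pIntegralPoly (natCast_mem _ n)
    have h1 : C (1 : ℚ) ∈ pIntegralPoly p := C_mem_pIntegralPoly (one_mem _)
    refine mul_mem (sub_mem (mul_mem (by exact_mod_cast hC 2) hX) h1) (sum_mem fun k hk => ?_)
    rw [mem_range] at hk
    rw [← mul_assoc, ← C_mul]
    refine mul_mem (C_mem_pIntegralPoly ?_) (mul_mem
      (prod_mem fun j _ => sub_mem (neg_mem hX) (hC j))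
      (prod_mem fun j _ => sub_mem (sub_mem hX h1) (hC j)))
    have hf : ¬ p ∣ k.factorial := by
      rw [(Fact.out : p.Prime).dvd_factorial]; exact hk.not_ge
    convert mul_mem (mul_mem (natCast_div_two_mul_add_one_mem hk) (harm2_mem_pIntegers hk))
      (pow_mem (inv_natCast_mem_pIntegers hf) 2) using 1
    ring
  · intro x
    simp only [eval_mul, eval_sub, eval_C, eval_X, eval_finsetSum, eval_prod, eval_neg,
      binomHarmSum, gchoose]
    congr 1
    refine sum_congr rfl fun k _ => ?_
    ring

end

theorem stmt_10 (p : ℕ) (hp : p.Prime) (hp3 : 3 < p) (a : ℚ) (ha : ¬ (p ∣ a.den))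
    (m : ℕ) (hm : 0 < m) (ham : CongrMod p 2 a m) :
    CongrMod p 2
      ((2 * a - 1) *
        ∑ k ∈ Finset.range p, gchoose (-a) k * gchoose (a - 1) k * harm2 k / (2 * k + 1))
      (-2 * ∑ k ∈ (Finset.Ico 1 m).filter (fun k => ¬ (p ∣ k)), (1 : ℚ) / (k : ℚ) ^ 2) ∧
    CongrMod p 2
      (-2 * ∑ k ∈ (Finset.Ico 1 m).filter (fun k => ¬ (p ∣ k)), (1 : ℚ) / (k : ℚ) ^ 2)
      ((2 - 2 * p) * bpoly (p ^ 2 - p - 1) a) := by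
  have : Fact p.Prime := ⟨hp⟩
  have haR : a ∈ pIntegers p := mem_pIntegers.2 ha
  have h2R : (2 : ℚ) ∈ pIntegers p := ofNat_mem _ 2
  rw [← binomHarmSum, congrMod_iff, congrMod_iff, sum_filter_Ico_inv_sq]
  rw [congrMod_iff] at ham
  obtain ⟨t, ht⟩ : ∃ t : ℕ, a - ((m + p ^ 2 * t : ℕ) : ℚ) ∈ primePow p (2 + 1) := by
    obtain ⟨z, hz, hza⟩ := mem_primePow.1 ham
    obtain ⟨t, ht⟩ := exists_natCast_sub_mem_primePow hz 1
    obtain ⟨w, hw, hwz⟩ := mem_primePow.1 ht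
    refine ⟨t, mem_primePow.2 ⟨w, hw, ?_⟩⟩
    push_cast
    linear_combination hza + (p : ℚ) ^ 2 * hwz
  set M := m + p ^ 2 * t with hM
  have hMR : (M : ℚ) ∈ pIntegers p := natCast_mem _ M
  have hTm := sum_inv_sq_sub_sum_pow_mem hp3 m
  have hTM := sum_inv_sq_sub_sum_pow_mem hp3 M
  have hper := sum_pow_add_sub_sum_pow_mem hp3 m t
  rw [← hM] at hper
  constructor
  · obtain ⟨Q, hQ, hev⟩ := exists_eval_eq_binomHarmSum p
    have h1 := eval_sub_eval_mem_primePow hQ haR hMR ht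
    rw [hev, hev] at h1
    have h2 := binomHarmSum_natCast_mem (p := p) (m := M) (by omega)
    have h3 := mul_mem_primePow h2R (sub_mem hTm (add_mem hTM hper))
    convert add_mem (add_mem h1 h2) h3 using 1
    ring
  · have h5 : p * 5 ≤ p ^ 2 := by
      rw [pow_two]
      refine Nat.mul_le_mul_left _ ?_
      by_contra h
      exact absurd hp (by rw [show p = 4 by omega]; decide)
    have hB := eval_sub_eval_mem_primePow
      (C_mul_bernoulli_mem_pIntegralPoly (by omega) (p ^ 2 - p - 1)) haR hMR ht
    have hs : p ^ 2 - p - 1 = (p ^ 2 - p - 2).succ := by omega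
    have hodd : Odd (p ^ 2 - p - 1) := by
      have := hp.odd_of_ne_two (by omega)
      obtain ⟨c, rfl⟩ := this
      refine ⟨2 * c ^ 2 + c - 1, ?_⟩
      have : (2 * c + 1) ^ 2 = 4 * c ^ 2 + 4 * c + 1 := by ring
      omega
    have hF := Polynomial.bernoulli_succ_eval M (p ^ 2 - p - 2)
    rw [← hs, bernoulli_eq_zero_of_odd hodd (by omega), zero_add] at hF
    have hcast : ((p ^ 2 - p - 2 : ℕ) : ℚ) = (p : ℚ) ^ 2 - p - 2 := by
      rw [Nat.sub_sub, Nat.cast_sub (by omega)]; push_cast; ring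
    rw [hcast] at hF
    have hpow : (p : ℚ) ^ 2 ∈ primePow p 2 := mem_primePow.2 ⟨1, one_mem _, one_mul _⟩
    set S := ∑ k ∈ range M, (k : ℚ) ^ (p ^ 2 - p - 2) with hS
    have hSR : S ∈ pIntegers p := sum_mem fun k _ => pow_mem (natCast_mem _ k) _
    have hpR : (p : ℚ) ∈ pIntegers p := natCast_mem _ p
    have h1 := mul_mem_primePow (mul_mem (mul_mem h2R hSR) (sub_mem hpR h2R)) hpow
    have h2 := mul_mem_primePow (mul_mem h2R (sub_mem hpR (one_mem _))) hB
    have h3 := mul_mem_primePow h2R (sub_mem hper hTm)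
    rw [bpoly]
    convert add_mem (add_mem h1 h2) h3 using 1
    rw [hF]
    ring
end

section
/- Let p > 3 be a prime and let a be a rational number whose denominator is coprime to p. Then Σ_{k=0}^{p-1} C(-a,k)·C(a-1,k)·H_k^{(2)} ≡ -E_{p-3}(a) (mod p). -/
open Finset

/-- Congruence modulo `p` between `p`-integral rational numbers. -/
def PCong (p : ℕ) (x y : ℚ) : Prop :=
  padicNorm p x ≤ 1 ∧ padicNorm p y ≤ 1 ∧ padicNorm p (x - y) < 1

namespace PCong

variable {p : ℕ} {x y z u v : ℚ}

theorem refl_of_le (h : padicNorm p x ≤ 1) : PCong p x x := ⟨h, h, by simp⟩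

theorem symm [Fact p.Prime] (h : PCong p x y) : PCong p y x :=
  ⟨h.2.1, h.1, by rw [← neg_sub, padicNorm.neg]; exact h.2.2⟩

theorem trans [Fact p.Prime] (h : PCong p x y) (h' : PCong p y z) : PCong p x z :=
  ⟨h.1, h'.2.1, by
    rw [← sub_add_sub_cancel x y z]
    exact padicNorm.nonarchimedean.trans_lt (max_lt h.2.2 h'.2.2)⟩

theorem add [Fact p.Prime] (h : PCong p x y) (h' : PCong p u v) : PCong p (x + u) (y + v) :=
  ⟨padicNorm.nonarchimedean.trans (max_le h.1 h'.1),
    padicNorm.nonarchimedean.trans (max_le h.2.1 h'.2.1), by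
    rw [add_sub_add_comm]
    exact padicNorm.nonarchimedean.trans_lt (max_lt h.2.2 h'.2.2)⟩

theorem mul [Fact p.Prime] (h : PCong p x y) (h' : PCong p u v) : PCong p (x * u) (y * v) := by
  refine ⟨?_, ?_, ?_⟩
  · rw [padicNorm.mul]
    exact mul_le_one₀ h.1 (padicNorm.nonneg _) h'.1
  · rw [padicNorm.mul]
    exact mul_le_one₀ h.2.1 (padicNorm.nonneg _) h'.2.1
  · rw [show x * u - y * v = x * (u - v) + (x - y) * v by ring]
    refine padicNorm.nonarchimedean.trans_lt (max_lt ?_ ?_) <;> rw [padicNorm.mul]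
    · exact mul_lt_one_of_nonneg_of_lt_one_right h.1 (padicNorm.nonneg _) h'.2.2
    · exact mul_lt_one_of_nonneg_of_lt_one_left (padicNorm.nonneg _) h.2.2 h'.2.1

theorem neg (h : PCong p x y) : PCong p (-x) (-y) := by
  refine ⟨?_, ?_, ?_⟩
  · rw [padicNorm.neg]; exact h.1
  · rw [padicNorm.neg]; exact h.2.1
  · rw [← neg_sub', padicNorm.neg]; exact h.2.2

theorem sub [Fact p.Prime] (h : PCong p x y) (h' : PCong p u v) : PCong p (x - u) (y - v) := by
  simpa only [sub_eq_add_neg] using h.add h'.neg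

theorem int [Fact p.Prime] (n : ℤ) : PCong p n n := refl_of_le (padicNorm.of_int n)

theorem nat [Fact p.Prime] (n : ℕ) : PCong p n n := refl_of_le (padicNorm.of_nat n)

theorem inv_nat [Fact p.Prime] {n : ℕ} (h : ¬ p ∣ n) : PCong p (n : ℚ)⁻¹ (n : ℚ)⁻¹ := by
  apply refl_of_le
  rw [← one_div, padicNorm.div, (padicNorm.nat_eq_one_iff n).2 h]
  simp

theorem sum [Fact p.Prime] {ι : Type*} {s : Finset ι} {f g : ι → ℚ}
    (h : ∀ i ∈ s, PCong p (f i) (g i)) : PCong p (∑ i ∈ s, f i) (∑ i ∈ s, g i) := by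
  classical
  induction s using Finset.induction_on with
  | empty => simpa using nat 0
  | insert i s hi ih =>
    rw [sum_insert hi, sum_insert hi]
    exact (h i (mem_insert_self i s)).add (ih fun j hj => h j (mem_insert_of_mem hj))

theorem prod [Fact p.Prime] {ι : Type*} {s : Finset ι} {f g : ι → ℚ}
    (h : ∀ i ∈ s, PCong p (f i) (g i)) : PCong p (∏ i ∈ s, f i) (∏ i ∈ s, g i) := by
  classical
  induction s using Finset.induction_on with
  | empty => simpa using nat 1
  | insert i s hi ih =>
    rw [prod_insert hi, prod_insert hi]
    exact (h i (mem_insert_self i s)).mul (ih fun j hj => h j (mem_insert_of_mem hj))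

theorem pow [Fact p.Prime] (h : PCong p x y) (n : ℕ) : PCong p (x ^ n) (y ^ n) := by
  simpa using prod (s := range n) fun _ _ => h

theorem of_int_dvd [Fact p.Prime] {m n : ℤ} (h : (p : ℤ) ∣ m - n) : PCong p m n :=
  ⟨padicNorm.of_int m, padicNorm.of_int n, by
    rw [← Int.cast_sub]; exact (padicNorm.int_lt_one_iff _).2 h⟩

theorem congrMod [Fact p.Prime] (h : PCong p x y) : CongrMod p 1 x y := by
  rw [CongrMod, or_iff_not_imp_left]
  intro hne
  have h1 := h.2.2
  rw [padicNorm.eq_zpow_of_nonzero (sub_ne_zero.2 hne),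
    zpow_lt_one_iff_right₀ (by exact_mod_cast (Fact.out : p.Prime).one_lt)] at h1
  push_cast
  omega

end PCong

theorem gchoose_pCong {p : ℕ} [Fact p.Prime] {x y : ℚ} (h : PCong p x y) {k : ℕ} (hk : k < p) :
    PCong p (gchoose x k) (gchoose y k) := by
  unfold gchoose
  rw [div_eq_mul_inv, div_eq_mul_inv]
  refine (PCong.prod fun j _ => h.sub (PCong.nat j)).mul (PCong.inv_nat ?_)
  rw [(Fact.out : p.Prime).dvd_factorial]
  omega

theorem harm2_pCong {p : ℕ} [Fact p.Prime] {k : ℕ} (hk : k < p) :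
    PCong p (harm2 k) (harm2 k) := by
  refine PCong.sum fun j hj => ?_
  have hj' := mem_range.1 hj
  rw [one_div, ← inv_pow]
  refine PCong.pow ?_ 2
  exact_mod_cast PCong.inv_nat (p := p) (n := j + 1)
    (Nat.not_dvd_of_pos_of_lt (by omega) (by omega))

theorem bernoulli'_pCong {p : ℕ} [Fact p.Prime] (n : ℕ) (hn : n + 1 < p) :
    PCong p (bernoulli' n) (bernoulli' n) := by
  induction n using Nat.strong_induction_on with
  | _ n ih =>
    rw [bernoulli'_def]
    have h1 : PCong p 1 1 := by exact_mod_cast PCong.nat 1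
    refine h1.sub (PCong.sum fun k hk => ?_)
    have hk' := mem_range.1 hk
    rw [div_eq_mul_inv]
    refine ((PCong.nat _).mul ?_).mul (ih k hk' (by omega))
    have := PCong.inv_nat (p := p) (n := n - k + 1)
      (Nat.not_dvd_of_pos_of_lt (by omega) (by omega))
    rw [Nat.cast_add, Nat.cast_sub hk'.le] at this
    exact_mod_cast this

theorem bernoulli_pCong {p : ℕ} [Fact p.Prime] (n : ℕ) (hn : n + 1 < p) :
    PCong p (bernoulli n) (bernoulli n) := by
  unfold bernoulli
  refine PCong.mul ?_ (bernoulli'_pCong n hn)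
  exact_mod_cast (PCong.int (-1)).pow n

theorem epoly_eq_sum (n : ℕ) (x : ℚ) :
    epoly n x = ∑ i ∈ range (n + 2), 2 * ((n + 1 : ℕ) : ℚ)⁻¹ *
      (bernoulli (n + 1 - i) * ((n + 1).choose i : ℕ) * (1 - 2 ^ (n + 1 - i))) * x ^ i := by
  unfold epoly bpoly
  simp only [Polynomial.bernoulli_def, Polynomial.eval_finsetSum, Polynomial.eval_monomial]
  rw [mul_sum, ← sum_sub_distrib, mul_sum]
  refine sum_congr rfl fun i hi => ?_
  have hi' := mem_range.1 hi
  have h2 : (2 : ℚ) ^ (n + 1) = 2 ^ (n + 1 - i) * 2 ^ i := by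
    rw [← pow_add]; congr 1; omega
  rw [h2, div_pow]
  push_cast
  field_simp

theorem epoly_pCong {p : ℕ} [Fact p.Prime] {n : ℕ} (hn : n + 2 < p) {x y : ℚ}
    (h : PCong p x y) : PCong p (epoly n x) (epoly n y) := by
  rw [epoly_eq_sum, epoly_eq_sum]
  have h1 : PCong p 1 1 := by exact_mod_cast PCong.nat 1
  have h2 : PCong p 2 2 := by exact_mod_cast PCong.nat 2
  refine PCong.sum fun i hi => ?_
  refine PCong.mul (PCong.mul (h2.mul (PCong.inv_nat ?_)) ?_) (h.pow i)
  · exact Nat.not_dvd_of_pos_of_lt (by omega) (by omega)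
  · exact ((bernoulli_pCong _ (by omega)).mul (PCong.nat _)).mul (h1.sub (h2.pow _))

theorem epoly_add_two (n : ℕ) (x : ℚ) :
    epoly n (x + 2) = epoly n x + 2 * ((x + 1) ^ n - x ^ n) := by
  unfold epoly bpoly
  rw [show x + 2 = 1 + (1 + x) by ring, Polynomial.bernoulli_eval_one_add,
    Polynomial.bernoulli_eval_one_add, show (1 + (1 + x)) / 2 = 1 + x / 2 by ring,
    Polynomial.bernoulli_eval_one_add]
  have : (n + 1 : ℚ) ≠ 0 := by positivity
  push_cast
  simp only [div_pow]
  field_simp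
  ring

theorem epoly_zero_of_even {n : ℕ} (hn : Even n) (h0 : n ≠ 0) : epoly n 0 = 0 := by
  unfold epoly bpoly
  rw [zero_div, Polynomial.bernoulli_eval_zero,
    bernoulli_eq_zero_of_odd hn.add_one (by omega)]
  simp

theorem epoly_one_of_even {n : ℕ} (hn : Even n) (h0 : n ≠ 0) : epoly n 1 = 0 := by
  unfold epoly bpoly
  have h := Polynomial.bernoulli_eval_one_sub (n + 1) (1 / 2)
  rw [hn.add_one.neg_one_pow, show (1 - 1 / 2 : ℚ) = 1 / 2 by norm_num] at h
  rw [Polynomial.bernoulli_eval_one, bernoulli'_eq_zero_of_odd hn.add_one (by omega),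
    show Polynomial.eval (1 / 2 : ℚ) (Polynomial.bernoulli (n + 1)) = 0 by linarith]
  simp

theorem epoly_natCast_succ_add {n : ℕ} (hn : Even n) (h0 : n ≠ 0) (m : ℕ) :
    epoly n (m + 1) + epoly n m = 2 * (m : ℚ) ^ n := by
  induction m with
  | zero => simp [epoly_zero_of_even hn h0, epoly_one_of_even hn h0, h0]
  | succ m ih =>
    push_cast
    rw [show (m : ℚ) + 1 + 1 = m + 2 by ring, epoly_add_two]
    linarith

/-- The product `∏_{j<k} (j² - a²)/(j+1)²`. -/
def sqProd (a : ℚ) (k : ℕ) : ℚ := ∏ j ∈ range k, ((j : ℚ) ^ 2 - a ^ 2) / (j + 1) ^ 2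

theorem sqProd_succ (a : ℚ) (k : ℕ) :
    sqProd a (k + 1) = sqProd a k * (((k : ℚ) ^ 2 - a ^ 2) / (k + 1) ^ 2) :=
  prod_range_succ _ _

theorem gchoose_succ (a : ℚ) (k : ℕ) : gchoose a (k + 1) = gchoose a k * (a - k) / (k + 1) := by
  unfold gchoose
  rw [prod_range_succ, Nat.factorial_succ]
  have := Nat.factorial_ne_zero k
  push_cast
  field_simp

theorem mul_gchoose_neg_mul_gchoose_sub_one (a : ℚ) (k : ℕ) :
    a * (gchoose (-a) k * gchoose (a - 1) k) = (a - k) * sqProd a k := by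
  induction k with
  | zero => simp [gchoose, sqProd]
  | succ k ih =>
    rw [gchoose_succ, gchoose_succ, sqProd_succ]
    have : (k + 1 : ℚ) ≠ 0 := by positivity
    push_cast
    field_simp
    linear_combination (-a - k) * (a - 1 - k) * ih

theorem mul_gchoose_neg_add_one_mul_gchoose (a : ℚ) (k : ℕ) :
    a * (gchoose (-(a + 1)) k * gchoose (a + 1 - 1) k) = (a + k) * sqProd a k := by
  induction k with
  | zero => simp [gchoose, sqProd]
  | succ k ih =>
    rw [gchoose_succ, gchoose_succ, sqProd_succ]
    have : (k + 1 : ℚ) ≠ 0 := by positivity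
    push_cast
    field_simp
    linear_combination (-(a + 1) - k) * (a + 1 - 1 - k) * ih

theorem sq_mul_sum_sqProd (a : ℚ) (K : ℕ) :
    a ^ 2 * ∑ k ∈ range K, sqProd a k = -((K : ℚ) ^ 2 * sqProd a K) := by
  induction K with
  | zero => simp
  | succ K ih =>
    rw [sum_range_succ, mul_add, ih, sqProd_succ]
    have : (K + 1 : ℚ) ≠ 0 := by positivity
    push_cast
    field_simp
    ring

theorem sq_mul_sum_sqProd_mul_harm2 (a : ℚ) (K : ℕ) :
    a ^ 2 * ∑ k ∈ range K, sqProd a k * harm2 k =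
      -((K : ℚ) ^ 2 * sqProd a K * harm2 K) + ∑ k ∈ range K, sqProd a k + sqProd a K - 1 := by
  induction K with
  | zero => simp [sqProd]
  | succ K ih =>
    rw [sum_range_succ, mul_add, ih, sqProd_succ, sum_range_succ _ K,
      show harm2 (K + 1) = harm2 K + 1 / ((K : ℚ) + 1) ^ 2 from sum_range_succ _ _]
    have : (K + 1 : ℚ) ≠ 0 := by positivity
    push_cast
    field_simp
    ring

theorem sqProd_natCast_eq_zero {n K : ℕ} (h : n < K) : sqProd n K = 0 :=
  prod_eq_zero (mem_range.2 h) (by simp)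

theorem sum_gchoose_harm2_succ_add {n K : ℕ} (hn : n ≠ 0) (h : n < K) :
    (∑ k ∈ range K, gchoose (-((n : ℚ) + 1)) k * gchoose ((n : ℚ) + 1 - 1) k * harm2 k) +
      ∑ k ∈ range K, gchoose (-(n : ℚ)) k * gchoose ((n : ℚ) - 1) k * harm2 k =
      -2 * ((n : ℚ)⁻¹) ^ 2 := by
  have hn' : (n : ℚ) ≠ 0 := by exact_mod_cast hn
  have h1 := sq_mul_sum_sqProd (n : ℚ) K
  have h2 := sq_mul_sum_sqProd_mul_harm2 (n : ℚ) K
  rw [sqProd_natCast_eq_zero h] at h1 h2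
  have h3 : ∑ k ∈ range K, sqProd (n : ℚ) k = 0 := by
    simpa [hn] using h1
  have h4 : (∑ k ∈ range K, gchoose (-((n : ℚ) + 1)) k * gchoose ((n : ℚ) + 1 - 1) k * harm2 k) +
      ∑ k ∈ range K, gchoose (-(n : ℚ)) k * gchoose ((n : ℚ) - 1) k * harm2 k =
      2 * ∑ k ∈ range K, sqProd (n : ℚ) k * harm2 k := by
    rw [← sum_add_distrib, mul_sum]
    refine sum_congr rfl fun k _ => mul_left_cancel₀ hn' ?_
    linear_combination harm2 k * mul_gchoose_neg_mul_gchoose_sub_one (n : ℚ) k +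
      harm2 k * mul_gchoose_neg_add_one_mul_gchoose (n : ℚ) k
  rw [h4]
  field_simp
  rw [h3] at h2
  linear_combination h2

theorem gchoose_zero_left (k : ℕ) : gchoose 0 k = if k = 0 then 1 else 0 := by
  split_ifs with h
  · simp [h, gchoose]
  · unfold gchoose
    rw [prod_eq_zero (i := 0) (mem_range.2 (by omega)) (by simp), zero_div]

theorem inv_sq_pCong_pow {p : ℕ} [Fact p.Prime] (hp3 : 3 ≤ p) {n : ℕ} (hn : ¬ p ∣ n) :
    PCong p ((n : ℚ)⁻¹ ^ 2) ((n : ℚ) ^ (p - 3)) := by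
  have hn0 : (n : ℚ) ≠ 0 := by
    rintro h
    exact hn (by simp [Nat.cast_eq_zero.1 h])
  have h1 : PCong p ((1 : ℤ) : ℚ) (((n : ℤ) ^ (p - 1) : ℤ) : ℚ) := by
    apply PCong.of_int_dvd
    rw [← ZMod.intCast_zmod_eq_zero_iff_dvd]
    push_cast
    rw [ZMod.pow_card_sub_one_eq_one, sub_self]
    rwa [Ne, ZMod.natCast_eq_zero_iff]
  have h2 := ((PCong.inv_nat hn).pow 2).mul h1
  push_cast at h2
  rw [show p - 1 = 2 + (p - 3) by omega, pow_add, ← mul_assoc, ← mul_pow,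
    inv_mul_cancel₀ hn0] at h2
  simpa using h2

theorem exists_nat_pCong {p : ℕ} [Fact p.Prime] {a : ℚ} (ha : ¬ p ∣ a.den) :
    ∃ n < p, PCong p a (n : ℚ) := by
  have hd : (a.den : ZMod p) ≠ 0 := by rwa [Ne, ZMod.natCast_eq_zero_iff]
  refine ⟨((a.num : ZMod p) / a.den).val, ZMod.val_lt _, ?_⟩
  set n := ((a.num : ZMod p) / a.den).val with hn
  have h1 : PCong p ((a.num : ℤ) : ℚ) (((n * a.den : ℕ) : ℤ) : ℚ) := by
    apply PCong.of_int_dvd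
    rw [← ZMod.intCast_zmod_eq_zero_iff_dvd]
    push_cast
    rw [hn, ZMod.natCast_zmod_val, div_mul_cancel₀ _ hd, sub_self]
  have h2 := h1.mul (PCong.inv_nat ha)
  have hd' : (a.den : ℚ) ≠ 0 := by exact_mod_cast a.den_nz
  push_cast at h2
  rwa [mul_inv_cancel_right₀ hd', ← div_eq_mul_inv, Rat.num_div_den] at h2

theorem sum_gchoose_harm2_natCast_pCong {p : ℕ} [Fact p.Prime] (hp3 : 3 < p) {n : ℕ}
    (hn : n ≤ p) :
    PCong p (∑ k ∈ range p, gchoose (-(n : ℚ)) k * gchoose ((n : ℚ) - 1) k * harm2 k)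
      (-(epoly (p - 3) n)) := by
  have hev : Even (p - 3) :=
    Nat.Odd.sub_odd ((Fact.out : p.Prime).odd_of_ne_two (by omega)) (by decide)
  have h0 : p - 3 ≠ 0 := by omega
  have hz : PCong p 0 0 := by exact_mod_cast PCong.nat 0
  have h2 : PCong p 2 2 := by exact_mod_cast PCong.nat 2
  have hharm : harm2 0 = 0 := by simp [harm2]
  induction n with
  | zero =>
    simpa [epoly_zero_of_even hev h0, gchoose_zero_left, hharm] using hz
  | succ n ih =>
    push_cast
    rcases eq_or_ne n 0 with rfl | hn0
    · simpa [epoly_one_of_even hev h0, gchoose_zero_left, hharm] using hz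
    · have hS := sum_gchoose_harm2_succ_add hn0 (show n < p by omega)
      have hE := epoly_natCast_succ_add hev h0 n
      rw [eq_sub_of_add_eq hS, eq_sub_of_add_eq hE, neg_sub', ← neg_mul]
      exact (h2.neg.mul (inv_sq_pCong_pow hp3.le
        (Nat.not_dvd_of_pos_of_lt (by omega) (by omega)))).sub (ih (by omega))

theorem stmt_11 (p : ℕ) (hp : p.Prime) (hp3 : 3 < p) (a : ℚ) (ha : ¬ (p ∣ a.den)) :
    CongrMod p 1
      (∑ k ∈ Finset.range p, gchoose (-a) k * gchoose (a - 1) k * harm2 k)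
      (-(epoly (p - 3) a)) := by
  have : Fact p.Prime := ⟨hp⟩
  obtain ⟨n, hn, han⟩ := exists_nat_pCong ha
  have h1 : PCong p 1 1 := by exact_mod_cast PCong.nat 1
  have hS : PCong p (∑ k ∈ range p, gchoose (-a) k * gchoose (a - 1) k * harm2 k)
      (∑ k ∈ range p, gchoose (-(n : ℚ)) k * gchoose ((n : ℚ) - 1) k * harm2 k) :=
    PCong.sum fun k hk =>
      ((gchoose_pCong han.neg (mem_range.1 hk)).mul
        (gchoose_pCong (han.sub h1) (mem_range.1 hk))).mul (harm2_pCong (mem_range.1 hk))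
  exact ((hS.trans (sum_gchoose_harm2_natCast_pCong hp3 hn.le)).trans
    (epoly_pCong (by omega) han).symm.neg).congrMod
end
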